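/- If (r_1, r_2, ..., r_l ; a_1, a_2, ..., a_l) is a reduced compatible sequence for a Grassmannian permutation, then Q̃((r_2, ..., r_l ; a_2, ..., a_l)) = jdt(Q̃((r_1, r_2, ..., r_l ; a_1, a_2, ..., a_l))); that is, deleting the first column of the biword corresponds to a jeu de taquin slide on the Edelman–Greene recording tableau. -/

import Mathlib

/- Common definitions for formalizing "Lenart's bijection via bumpless pipe dreams"
   (Gregory–Hamaker). -/

namespace BPDPaper

/-! ### Permutations of the positive integers -/

/-- We model permutations of the positive integers as permutations of `ℕ`
(fixing `0`, with finite support). -/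
abbrev Perm' := Equiv.Perm ℕ

/-- The simple transposition `s_a = t_{a,a+1}`. -/
def sT (a : ℕ) : Perm' := Equiv.swap a (a + 1)

/-- The transposition `t_{ij}`. -/
def tT (i j : ℕ) : Perm' := Equiv.swap i j

/-- The product `s_{a_1} ⋯ s_{a_p}` of a word. -/
def wordProd (l : List ℕ) : Perm' := (l.map sT).prod

/-- `l` is a word for `w` (in the letters `s_1, s_2, …`). -/
def IsWord (w : Perm') (l : List ℕ) : Prop := (∀ x ∈ l, 1 ≤ x) ∧ wordProd l = w

/-- The Coxeter length `ℓ(w)`: the minimal length of a word for `w`. -/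
noncomputable def plen (w : Perm') : ℕ :=
  sInf {m | ∃ l : List ℕ, IsWord w l ∧ l.length = m}

/-- `l` is a reduced word for `w`. -/
def IsReducedWord (w : Perm') (l : List ℕ) : Prop := IsWord w l ∧ l.length = plen w

/-- A permutation of the positive integers: fixes `0` and all but finitely many points. -/
def IsPerm (w : Perm') : Prop := w 0 = 0 ∧ {k | w k ≠ k}.Finite

/-- `k` is a descent of `w`. -/
def Descent (w : Perm') (k : ℕ) : Prop := 1 ≤ k ∧ w (k + 1) < w k

/-- `w` is Grassmannian: at most one descent. -/
def Grassmannian (w : Perm') : Prop := IsPerm w ∧ Set.Subsingleton {k | Descent w k}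

/-- `w` is vexillary: no indices `i < j < k < l` with `w j < w i < w l < w k`
(pattern 2143 avoidance). -/
def Vexillary (w : Perm') : Prop := IsPerm w ∧
  ¬ ∃ i j k l : ℕ, 1 ≤ i ∧ i < j ∧ j < k ∧ k < l ∧ w j < w i ∧ w i < w l ∧ w l < w k

/-- The code `c_i(w) = #{j > i : w j < w i}`. -/
noncomputable def codeOf (w : Perm') (i : ℕ) : ℕ := Nat.card {j : ℕ | i < j ∧ w j < w i}

/-- Insert into a weakly decreasing list, keeping it weakly decreasing. -/
def insDesc (x : ℕ) : List ℕ → List ℕ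
  | [] => [x]
  | y :: ys => if y < x then x :: y :: ys else y :: insDesc x ys

/-- Sort a list into weakly decreasing order. -/
def sortDesc (l : List ℕ) : List ℕ := l.foldr insDesc []

/-- The shape `λ(w)`: the code `(c_1(w), …, c_n(w))` sorted decreasingly, zeros dropped
(`n` is any bound on the support of `w`). -/
noncomputable def shapeOf (w : Perm') (n : ℕ) : List ℕ :=
  (sortDesc ((List.range' 1 n).map (codeOf w))).filter (fun x => decide (0 < x))

/-- The Rothe diagram `D_w = {(i, w j) : i < j, w j < w i}` (matrix coordinates). -/
def RotheDiagram (w : Perm') : Set (ℕ × ℕ) :=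
  {p | 1 ≤ p.1 ∧ ∃ j, p.1 < j ∧ w j < w p.1 ∧ p.2 = w j}

/-- `φ_i`: the row index of the southeast-most box of `D_w` on the diagonal through
`(i, λ_i)`. -/
noncomputable def flagEntry (w : Perm') (i li : ℕ) : ℕ :=
  sSup {r : ℕ | ∃ c : ℕ, (r, c) ∈ RotheDiagram w ∧ (c : ℤ) - (r : ℤ) = (li : ℤ) - (i : ℤ)}

/-- The flag `φ(w) = (φ_1, …, φ_m)` of a vexillary permutation. -/
noncomputable def flagOf (w : Perm') (n : ℕ) : List ℕ :=
  (List.range (shapeOf w n).length).map (fun k => flagEntry w (k + 1) ((shapeOf w n).getD k 0))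

/-- `ρ(w)_i`: the `i`-th row of the smallest partition whose Young diagram contains `D_w`. -/
noncomputable def rhoRow (w : Perm') (i : ℕ) : ℕ :=
  sSup {c : ℕ | ∃ r : ℕ, i ≤ r ∧ (r, c) ∈ RotheDiagram w}

/-! ### Tableaux (lists of rows), flagged SSYT, jeu de taquin -/

/-- Semistandard Young tableau of partition shape, presented as a list of rows. -/
def IsSSYT (T : List (List ℕ)) : Prop :=
  (∀ row ∈ T, row ≠ []) ∧
  List.Chain' (fun r1 r2 : List ℕ => r2.length ≤ r1.length) T ∧
  (∀ row ∈ T, List.Chain' (· ≤ ·) row) ∧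
  (∀ i j : ℕ, i + 1 < T.length → j < (T.getD (i + 1) []).length →
    (T.getD i []).getD j 0 < (T.getD (i + 1) []).getD j 0)

/-- `φ`-flagged semistandard Young tableaux of shape `λ`: the last entry of row `i`
is at most `φ_i`. -/
def IsFlaggedSSYT (lam phi : List ℕ) (T : List (List ℕ)) : Prop :=
  IsSSYT T ∧ T.map List.length = lam ∧
  ∀ i : ℕ, i < T.length → (T.getD i []).getLastD 0 ≤ phi.getD i 0

/-- Semistandard Young tableaux with all entries at most `k` (`SSYT_k`). -/
def IsSSYTBounded (k : ℕ) (T : List (List ℕ)) : Prop :=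
  IsSSYT T ∧ ∀ row ∈ T, ∀ x ∈ row, x ≤ k

/-- Set an entry of a tableau. -/
def setEntry (T : List (List ℕ)) (r c x : ℕ) : List (List ℕ) :=
  T.set r ((T.getD r []).set c x)

/-- One jeu de taquin slide with the empty tile at `(r, c)` (0-indexed):
swap the empty tile with the smaller of the entries to its right and below
(ties move down; missing boxes are `∞`); when both are missing, delete the cell. -/
def jdtAux : ℕ → List (List ℕ) → ℕ → ℕ → List (List ℕ)
  | 0, T, _, _ => T
  | fuel + 1, T, r, c =>
    match (T.getD r [])[c + 1]?, (T.getD (r + 1) [])[c]? with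
    | none, none => (T.set r ((T.getD r []).take c)).filter (fun row => !row.isEmpty)
    | some x, none => jdtAux fuel (setEntry T r c x) r (c + 1)
    | none, some y => jdtAux fuel (setEntry T r c y) (r + 1) c
    | some x, some y =>
      if x < y then jdtAux fuel (setEntry T r c x) r (c + 1)
      else jdtAux fuel (setEntry T r c y) (r + 1) c

/-- `jdt(T)`: remove the top-left box of `T` and rectify by jeu de taquin. -/
def jdt (T : List (List ℕ)) : List (List ℕ) :=
  jdtAux ((T.map List.length).sum + 1) T 0 0

/-! ### Edelman–Greene column insertion and the recording tableau -/

/-- Edelman–Greene insertion of `x` into one increasing column `C`.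
Returns the new column together with `none` (if `x` was appended, creating a new box)
or `some y` (where `y` is to be inserted into the next column). -/
def colIns (x : ℕ) (C : List ℕ) : List ℕ × Option ℕ :=
  if C.all (fun c => decide (c < x)) then (C ++ [x], none)
  else if x ∈ C ∧ (x + 1) ∈ C then (C, some (x + 1))
  else
    match C.find? (fun c => decide (x < c)) with
    | some ck => (C.map (fun c => if c = ck then x else c), some ck)
    | none => (C, none)

/-- Edelman–Greene insertion of `x` into a tableau presented as a list of columns.
Returns the new columns and the (0-indexed) column containing the new box. -/
def egInsert : List (List ℕ) → ℕ → (List (List ℕ)) × ℕ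
  | [], x => ([[x]], 0)
  | C :: rest, x =>
    match colIns x C with
    | (C', none) => (C' :: rest, 0)
    | (C', some y) =>
      let res := egInsert rest y
      (C' :: res.1, res.2 + 1)

/-- One step of the Edelman–Greene algorithm on the pair (insertion, recording) tableau:
insert `ra.2` into `P` and record `ra.1` in the new box of `Q`. -/
def egStep (PQ : (List (List ℕ)) × (List (List ℕ))) (ra : ℕ × ℕ) :
    (List (List ℕ)) × (List (List ℕ)) :=
  let res := egInsert PQ.1 ra.2
  let Q := PQ.2
  let Q' := if res.2 < Q.length then Q.set res.2 (Q.getD res.2 [] ++ [ra.1]) else Q ++ [[ra.1]]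
  (res.1, Q')

/-- A biword `(r_1,…,r_l ; a_1,…,a_l)`. -/
structure Biword where
  top : List ℕ
  bot : List ℕ

/-- The (insertion, recording) column tableaux of a biword under Edelman–Greene insertion. -/
def egPQ (P : Biword) : (List (List ℕ)) × (List (List ℕ)) :=
  (P.top.zip P.bot).foldl egStep ([], [])

/-- Convert a tableau presented as a list of columns into a list of rows. -/
def colsToRows (cols : List (List ℕ)) : List (List ℕ) :=
  (List.range ((cols.map List.length).foldr max 0)).map
    (fun i => cols.filterMap (fun col => col[i]?))

/-- The Edelman–Greene recording tableau `Q̃` of a biword (as a list of rows). -/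
def Qtilde (P : Biword) : List (List ℕ) := colsToRows (egPQ P).2

/-- The Edelman–Greene insertion tableau `P̃` of a biword (as a list of rows). -/
def Ptilde (P : Biword) : List (List ℕ) := colsToRows (egPQ P).1

/-- `(r ; a)` is a reduced compatible sequence for `w`: `a` is a reduced word for `w`,
`r` is weakly increasing, `r_i ≤ a_i`, and `r_i < r_{i+1}` whenever `a_i < a_{i+1}`.
Membership in `PD(w)`. -/
def IsCompatible (w : Perm') (P : Biword) : Prop :=
  IsReducedWord w P.bot ∧
  List.Chain' (· ≤ ·) P.top ∧
  List.Forall₂ (· ≤ ·) P.top P.bot ∧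
  (∀ m : ℕ, m + 1 < P.bot.length →
    P.bot.getD m 0 < P.bot.getD (m + 1) 0 → P.top.getD m 0 < P.top.getD (m + 1) 0)

/-! ### Bumpless pipe dreams -/

/-- The tiles: blank, vertical, horizontal, ⌐-elbow (S–E, "r"), ⌟-elbow (W–N, "j"),
crossing, and the bump tile (for almost bumpless pipe dreams). -/
inductive Tile
  | blank | vert | horiz | se | nw | cross | bump
deriving DecidableEq

/-- A square grid of tiles; rows and columns are 1-indexed, rows increase downward. -/
structure Grid where
  n : ℕ
  tile : ℕ → ℕ → Tile

inductive Dir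
  | north | east
deriving DecidableEq

def hasN : Tile → Bool
  | .vert => true | .nw => true | .cross => true | .bump => true | _ => false
def hasS : Tile → Bool
  | .vert => true | .se => true | .cross => true | .bump => true | _ => false
def hasE : Tile → Bool
  | .horiz => true | .se => true | .cross => true | .bump => true | _ => false
def hasW : Tile → Bool
  | .horiz => true | .nw => true | .cross => true | .bump => true | _ => false

/-- The outgoing direction of a pipe through a tile, given the incoming heading
(`north` = entered through the south edge, `east` = entered through the west edge). -/
def outDir : Tile → Dir → Option Dir
  | .vert, .north => some .north
  | .cross, .north => some .north
  | .se, .north => some .east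
  | .bump, .north => some .east
  | .horiz, .east => some .east
  | .cross, .east => some .east
  | .nw, .east => some .north
  | .bump, .east => some .north
  | _, _ => none

/-- Trace a pipe; returns the row in which it exits through the east edge of the grid. -/
def traceAux (g : Grid) : ℕ → ℕ → ℕ → Dir → Option ℕ
  | 0, _, _, _ => none
  | fuel + 1, x, y, d =>
    match outDir (g.tile x y) d with
    | none => none
    | some Dir.north => if x ≤ 1 then none else traceAux g fuel (x - 1) y Dir.north
    | some Dir.east => if g.n ≤ y then some x else traceAux g fuel x (y + 1) Dir.east

/-- The exit row of the pipe entering at the bottom of column `c`. -/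
def exitRow (g : Grid) (c : ℕ) : Option ℕ := traceAux g (2 * g.n + 2) g.n c Dir.north

/-- The list of states `(row, column, heading)` visited by a pipe. -/
def pathAux (g : Grid) : ℕ → ℕ → ℕ → Dir → List (ℕ × ℕ × Dir)
  | 0, _, _, _ => []
  | fuel + 1, x, y, d =>
    (x, y, d) ::
      (match outDir (g.tile x y) d with
       | none => []
       | some Dir.north => if x ≤ 1 then [] else pathAux g fuel (x - 1) y Dir.north
       | some Dir.east => if g.n ≤ y then [] else pathAux g fuel x (y + 1) Dir.east)

/-- The path of the pipe entering at the bottom of column `c`. -/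
def pipePath (g : Grid) (c : ℕ) : List (ℕ × ℕ × Dir) := pathAux g (2 * g.n + 2) g.n c Dir.north

/-- Pipe `c` passes through position `z`. -/
def passes (g : Grid) (c : ℕ) (z : ℕ × ℕ) : Prop :=
  ∃ d : Dir, (z.1, z.2, d) ∈ pipePath g c

def InGrid (g : Grid) (i j : ℕ) : Prop := 1 ≤ i ∧ i ≤ g.n ∧ 1 ≤ j ∧ j ≤ g.n

/-- A (reduced) bumpless pipe dream: tiles match along edges; pipes enter along the
bottom and exit along the right; no bump tiles; no two pipes cross more than once.
(Tiles outside the grid are normalized to `horiz`.) -/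
def IsBPD (g : Grid) : Prop :=
  1 ≤ g.n ∧
  (∀ i j, ¬ InGrid g i j → g.tile i j = Tile.horiz) ∧
  (∀ i j, InGrid g i j → g.tile i j ≠ Tile.bump) ∧
  (∀ i j, 1 ≤ i → i < g.n → 1 ≤ j → j ≤ g.n → hasS (g.tile i j) = hasN (g.tile (i + 1) j)) ∧
  (∀ i j, 1 ≤ i → i ≤ g.n → 1 ≤ j → j < g.n → hasE (g.tile i j) = hasW (g.tile i (j + 1))) ∧
  (∀ j, 1 ≤ j → j ≤ g.n → hasN (g.tile 1 j) = false) ∧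
  (∀ j, 1 ≤ j → j ≤ g.n → hasS (g.tile g.n j) = true) ∧
  (∀ i, 1 ≤ i → i ≤ g.n → hasW (g.tile i 1) = false) ∧
  (∀ i, 1 ≤ i → i ≤ g.n → hasE (g.tile i g.n) = true) ∧
  (∀ c c', 1 ≤ c → c ≤ g.n → 1 ≤ c' → c' ≤ g.n → c ≠ c' →
    Set.Subsingleton {z : ℕ × ℕ | g.tile z.1 z.2 = Tile.cross ∧ passes g c z ∧ passes g c' z})

/-- `g ∈ BPD(w)`: `g` is a bumpless pipe dream whose permutation is `w`, i.e. the pipe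
entering at the bottom of column `c` exits to the right in row `w⁻¹(c)`. -/
def MemBPD (w : Perm') (g : Grid) : Prop :=
  IsBPD g ∧ w 0 = 0 ∧ (∀ k, g.n < k → w k = k) ∧
  (∀ c, 1 ≤ c → c ≤ g.n → exitRow g c = some (w.symm c))

/-! ### Weigandt's map γ -/

/-- The blank tiles on the diagonal `{(i,j) : j - i = d}`, from northwest to southeast. -/
def blanksOnDiag (g : Grid) (d : ℤ) : List (ℕ × ℕ) :=
  (List.range' 1 g.n).filterMap (fun (i : ℕ) =>
    let jz : ℤ := (i : ℤ) + d
    if 1 ≤ jz ∧ jz ≤ (g.n : ℤ) then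
      (if g.tile i jz.toNat = Tile.blank then some (i, jz.toNat) else none)
    else none)

/-- The number of pipes passing above position `(i,j)`: tiles above it in column `j`
in which a pipe travels eastward. -/
def pipesAbove (g : Grid) (i j : ℕ) : ℕ :=
  ((List.range' 1 g.n).filter (fun x => decide (x < i) && hasE (g.tile x j))).length

/-- Weigandt's map `γ` (for vexillary permutations): fill each blank tile with the number
of pipes above it, slide the filled tiles northwest along their diagonals into the Young
diagram of `lam`, and add `i` to every entry in row `i`. -/
def weigandt (g : Grid) (lam : List ℕ) : List (List ℕ) :=
  (List.range lam.length).map (fun (r0 : ℕ) =>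
    (List.range (lam.getD r0 0)).map (fun (c0 : ℕ) =>
      let r : ℕ := r0 + 1
      let c : ℕ := c0 + 1
      let p := (blanksOnDiag g ((c : ℤ) - (r : ℤ))).getD (min r c - 1) (0, 0)
      pipesAbove g p.1 p.2 + r))

/-! ### The Gao–Huang operator ∇, pop, and the bijection φ -/

/-- Backward tracing: enter tile `(x,y)` through its north edge (`viaN = true`) or its
east edge (`viaN = false`) and follow the pipe backwards; returns the bottom column
at which the pipe enters the grid. -/
def backAux (g : Grid) : ℕ → ℕ → ℕ → Bool → Option ℕ
  | 0, _, _, _ => none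
  | fuel + 1, x, y, viaN =>
    if g.n < x then none
    else if viaN then
      match g.tile x y with
      | .vert | .cross => if x = g.n then some y else backAux g fuel (x + 1) y true
      | .nw | .bump => backAux g fuel x (y - 1) false
      | _ => none
    else
      match g.tile x y with
      | .horiz | .cross => backAux g fuel x (y - 1) false
      | .se | .bump => if x = g.n then some y else backAux g fuel (x + 1) y true
      | _ => none

/-- The label of the pipe passing through `(x,y)` entering from the south. -/
def pipeFromS (g : Grid) (x y : ℕ) : Option ℕ :=
  if x = g.n then some y else backAux g (2 * g.n + 2) (x + 1) y true

/-- Move the mark east to the rightmost blank tile in its contiguous block of blanks. -/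
def slideEast (g : Grid) (i j : ℕ) : ℕ :=
  ((List.range' j (g.n + 1)).takeWhile (fun y => g.tile i y == Tile.blank)).getLastD j

/-- Tile rewrite for the undroop of the pipe `p` (from `(i', j+1)` into `(i, j)`)
performed in one iteration of the Gao–Huang procedure; the `(i', j+1)` case `cross → se`
is the final uncrossing step. -/
def nablaUndroop (T : ℕ → ℕ → Tile) (i i' j : ℕ) : ℕ → ℕ → Tile := fun x y =>
  let t := T x y
  if x = i ∧ y = j then (match t with | Tile.blank => Tile.se | _ => t)
  else if x = i' ∧ y = j then
    (match t with | Tile.se => Tile.vert | Tile.horiz => Tile.nw | _ => t)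
  else if x = i ∧ y = j + 1 then
    (match t with | Tile.se => Tile.horiz | Tile.vert => Tile.nw | _ => t)
  else if x = i' ∧ y = j + 1 then
    (match t with | Tile.nw => Tile.blank | Tile.cross => Tile.se | _ => t)
  else if y = j ∧ i < x ∧ x < i' then
    (match t with | Tile.blank => Tile.vert | Tile.horiz => Tile.cross | _ => t)
  else if y = j + 1 ∧ i < x ∧ x < i' then
    (match t with | Tile.vert => Tile.blank | Tile.cross => Tile.horiz | _ => t)
  else t

/-- Tile rewrite for the droop (from `(k, j)` into `(k', j+1)`) of a pipe `q` having both
a ⌐-turn and a ⌟-turn in column `j`, performed after the undroop of `p`. -/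
def nablaQDroop (T : ℕ → ℕ → Tile) (k k' j : ℕ) : ℕ → ℕ → Tile := fun x y =>
  let t := T x y
  if x = k ∧ y = j then (match t with | Tile.se => Tile.vert | _ => t)
  else if x = k' ∧ y = j then (match t with | Tile.nw => Tile.cross | _ => t)
  else if x = k ∧ y = j + 1 then (match t with | Tile.horiz => Tile.se | _ => t)
  else if x = k' ∧ y = j + 1 then (match t with | Tile.blank => Tile.nw | _ => t)
  else if y = j + 1 ∧ k < x ∧ x < k' then
    (match t with | Tile.blank => Tile.vert | Tile.horiz => Tile.cross | _ => t)
  else t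

/-- The ⌐/⌟ elbow pairs `(k, k')` of pipes in column `j` strictly between rows `i` and `i'`. -/
def qPairs (g : Grid) (i i' j : ℕ) : List (ℕ × ℕ) :=
  (List.range' 1 g.n).filterMap (fun k =>
    if i < k ∧ k < i' ∧ g.tile k j = Tile.se then
      match (List.range' 1 g.n).find?
          (fun k' => decide (k < k' ∧ k' < i' ∧ g.tile k' j = Tile.nw)) with
      | some k' => some (k, k')
      | none => none
    else none)

/-- One iteration of the marked-tile procedure on the rectangle with corners
`(i, j)` and `(i', j+1)`: undroop `p`, then droop the intersecting pipes. -/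
def nablaIter (g : Grid) (i i' j : ℕ) : Grid :=
  ⟨g.n, (qPairs g i i' j).foldl (fun T kk => nablaQDroop T kk.1 kk.2 j)
    (nablaUndroop g.tile i i' j)⟩

/-- The marked-tile loop of the Gao–Huang procedure; returns `(∇B, a)`. -/
def nablaLoop (g : Grid) : ℕ → ℕ × ℕ → Grid × ℕ
  | 0, _ => (g, 0)
  | fuel + 1, (i, j0) =>
    let j := slideEast g i j0
    match pipeFromS g i (j + 1) with
    | none => (g, 0)
    | some p =>
      if p = j + 1 then
        match (List.range' 1 g.n).find? (fun x =>
            decide (i < x) && (g.tile x (j + 1) == Tile.cross) &&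
            (backAux g (2 * g.n + 2) x (j + 1) false == some j)) with
        | some i' => (nablaIter g i i' j, j)
        | none => (g, 0)
      else
        match (List.range' 1 g.n).find? (fun x =>
            decide (i < x) && (g.tile x (j + 1) == Tile.nw)) with
        | some i' => nablaLoop (nablaIter g i i' j) fuel (i', j + 1)
        | none => (g, 0)

/-- The Gao–Huang procedure: returns `(∇B, (r, a))` where `pop(B) = (r, a)`. -/
def nablaPop (g : Grid) : Grid × ℕ × ℕ :=
  match (List.range' 1 g.n).find?
      (fun i => (List.range' 1 g.n).any (fun j => g.tile i j == Tile.blank)) with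
  | none => (g, 0, 0)
  | some r =>
    let j0 := ((List.range' 1 g.n).filter (fun j => g.tile r j == Tile.blank)).getLastD 0
    let res := nablaLoop g (g.n + 1) (r, j0)
    (res.1, r, res.2)

/-- The Gao–Huang operator `∇`. -/
def nabla (g : Grid) : Grid := (nablaPop g).1

/-- `pop(B) = (r, a)`. -/
def pop (g : Grid) : ℕ × ℕ := (nablaPop g).2

/-- The number of crossing tiles of `g` (which equals `ℓ(w)` for `g ∈ BPD(w)`). -/
def crossCount (g : Grid) : ℕ :=
  ((List.range' 1 g.n).map (fun i =>
    ((List.range' 1 g.n).filter (fun j => g.tile i j == Tile.cross)).length)).sum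

def phiAux : ℕ → Grid → List (ℕ × ℕ)
  | 0, _ => []
  | l + 1, g => pop g :: phiAux l (nabla g)

/-- The Gao–Huang bijection `φ : BPD(w) → PD(w)`,
`φ(B) = (r_1,…,r_l ; a_1,…,a_l)` with `(r_i, a_i) = pop(∇^{i-1} B)`. -/
def phi (g : Grid) : Biword :=
  ⟨(phiAux (crossCount g) g).map Prod.fst, (phiAux (crossCount g) g).map Prod.snd⟩

/-! ### Little bumps (relational) -/

/-- The reflection labelling the crossing at position `m` (0-indexed) of the word `a`:
deleting the letter at position `m` from `a` yields a word for `wordProd a * crossingRefl a m`.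
The wires `i` and `j` cross at position `m` iff `crossingRefl a m = t_{ij}`. -/
def crossingRefl (a : List ℕ) (m : ℕ) : Perm' :=
  (wordProd (a.drop (m + 1)))⁻¹ * sT (a.getD m 0) * wordProd (a.drop (m + 1))

/-- `a` is a reduced word (for its own product). -/
def IsReducedSelf (a : List ℕ) : Prop := IsReducedWord (wordProd a) a

/-- Increment the entry of `a` at position `m`. -/
def incrAt (a : List ℕ) (m : ℕ) : List ℕ := a.set m (a.getD m 0 + 1)

/-- The (upward) Little bump `L_{ij}` as a relation on biwords: starting at the position
`m_1` where wires `i` and `j` cross, repeatedly increment the current entry; stop when the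
bottom word becomes reduced, and otherwise move to the unique other position whose crossing
involves the same pair of wires. -/
def LittleBumpRel (i j : ℕ) (P P' : Biword) : Prop :=
  P'.top = P.top ∧
  ∃ ms : List ℕ, ∃ ws : List (List ℕ),
    ms ≠ [] ∧
    ws.length = ms.length + 1 ∧
    ws.getD 0 [] = P.bot ∧
    ws.getLastD [] = P'.bot ∧
    (∀ t : ℕ, t < ms.length → ws.getD (t + 1) [] = incrAt (ws.getD t []) (ms.getD t 0)) ∧
    crossingRefl P.bot (ms.getD 0 0) = tT i j ∧
    (∀ t : ℕ, t + 1 < ms.length →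
      ¬ IsReducedSelf (ws.getD (t + 1) []) ∧
      ms.getD (t + 1) 0 ≠ ms.getD t 0 ∧
      crossingRefl (ws.getD (t + 1) []) (ms.getD t 0)
        = crossingRefl (ws.getD (t + 1) []) (ms.getD (t + 1) 0)) ∧
    IsReducedSelf P'.bot

/-! ### Huang bumps -/

/-- Least offset `t ≥ 1` satisfying `p` (searched up to `bound + 1`). -/
def leastOff (p : ℕ → Bool) (bound : ℕ) : ℕ :=
  ((List.range' 1 (bound + 1)).filter p).headD 1

/-- The southeast corner `(x + k, y + l)` of the min-droop at `(x, y)`: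
`k, l ≥ 1` minimal with `(x+k, y)` and `(x, y+l)` not crossing tiles. -/
def minDroopCorner (g : Grid) (x y : ℕ) : ℕ × ℕ :=
  (x + leastOff (fun k => !(g.tile (x + k) y == Tile.cross)) g.n,
   y + leastOff (fun l => !(g.tile x (y + l) == Tile.cross)) g.n)

/-- The min-droop at `(x, y)`: droop the ⌐-turn at `(x, y)` into `(x+k, y+l)`. -/
def minDroopT (g : Grid) (x y : ℕ) : Grid :=
  let k := leastOff (fun k => !(g.tile (x + k) y == Tile.cross)) g.n
  let l := leastOff (fun l => !(g.tile x (y + l) == Tile.cross)) g.n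
  ⟨g.n, fun a b =>
    let t := g.tile a b
    if a = x ∧ b = y then
      (match t with | Tile.se => Tile.blank | Tile.bump => Tile.nw | _ => t)
    else if a = x + k ∧ b = y then (match t with | Tile.vert => Tile.se | _ => t)
    else if a = x ∧ b = y + l then
      (match t with | Tile.horiz => Tile.se | Tile.nw => Tile.vert | _ => t)
    else if a = x + k ∧ b = y + l then
      (match t with | Tile.blank => Tile.nw | Tile.se => Tile.bump | _ => t)
    else if b = y ∧ x < a ∧ a < x + k then
      (match t with | Tile.cross => Tile.horiz | Tile.vert => Tile.blank | _ => t)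
    else if a = x ∧ y < b ∧ b < y + l then
      (match t with | Tile.cross => Tile.vert | Tile.horiz => Tile.blank | _ => t)
    else if a = x + k ∧ y < b ∧ b < y + l then
      (match t with | Tile.blank => Tile.horiz | Tile.vert => Tile.cross | _ => t)
    else if b = y + l ∧ x < a ∧ a < x + k then
      (match t with | Tile.blank => Tile.vert | Tile.horiz => Tile.cross | _ => t)
    else t⟩

/-- Replace a single tile. -/
def setTile (g : Grid) (x y : ℕ) (t : Tile) : Grid :=
  ⟨g.n, fun a b => if a = x ∧ b = y then t else g.tile a b⟩

/-- Pipe `c` passes through `(x, y)` (Boolean). -/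
def onPath (g : Grid) (c : ℕ) (x y : ℕ) : Bool :=
  decide ((x, y, Dir.north) ∈ pipePath g c) || decide ((x, y, Dir.east) ∈ pipePath g c)

/-- The position of the crossing tile where pipes `c` and `c'` cross, if any. -/
def findCrossing (g : Grid) (c c' : ℕ) : Option (ℕ × ℕ) :=
  (pipePath g c).findSome? (fun s =>
    if (g.tile s.1 s.2.1 == Tile.cross) && onPath g c' s.1 s.2.1 then some (s.1, s.2.1)
    else none)

/-- The column of the ⌐-turn of pipe `c` in row `row`, if any. -/
def seTurnCol (g : Grid) (c row : ℕ) : Option ℕ :=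
  (pipePath g c).findSome? (fun s =>
    if s.1 = row ∧ s.2.2 = Dir.north ∧
        (g.tile s.1 s.2.1 = Tile.se ∨ g.tile s.1 s.2.1 = Tile.bump) then some s.2.1
    else none)

/-- The iteration of the Huang bump: min-droops and cross-bump-swaps until a bump tile
is turned into a crossing tile. -/
def huangLoop (iPipe : ℕ) : ℕ → Grid → ℕ × ℕ → Grid
  | 0, g, _ => g
  | fuel + 1, g, (x, y) =>
    let c := minDroopCorner g x y
    let g1 := minDroopT g x y
    match g1.tile c.1 c.2 with
    | Tile.nw =>
      match seTurnCol g1 iPipe c.1 with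
      | some col => huangLoop iPipe fuel g1 (c.1, col)
      | none => g1
    | Tile.bump =>
      match backAux g1 (2 * g1.n + 2) c.1 c.2 false with
      | some q =>
        match findCrossing g1 iPipe q with
        | some z =>
          huangLoop iPipe fuel (setTile (setTile g1 c.1 c.2 Tile.cross) z.1 z.2 Tile.bump) z
        | none => setTile g1 c.1 c.2 Tile.cross
      | none => g1
    | _ => g1

/-- Fuel exceeding the number of states of the procedure. -/
def huangFuel (g : Grid) : ℕ := 7 ^ (g.n * g.n) * (g.n * g.n) + 2

/-- The Huang bump `H_{ij}`: replace the crossing of pipes `i` and `j` by a bump tile,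
then repeatedly min-droop and cross-bump-swap until a new crossing tile is created. -/
def huang (i j : ℕ) (g : Grid) : Grid :=
  match findCrossing g i j with
  | some z => huangLoop i (huangFuel g) (setTile g z.1 z.2 Tile.bump) z
  | none => g


/-! ### Reduced words of Grassmannian permutations -/

theorem wordProd_cons (a : ℕ) (l : List ℕ) : wordProd (a :: l) = sT a * wordProd l := by
  simp [wordProd]

theorem wordProd_append (l₁ l₂ : List ℕ) : wordProd (l₁ ++ l₂) = wordProd l₁ * wordProd l₂ := by
  simp [wordProd]

theorem sT_mul_self (a : ℕ) : sT a * sT a = 1 := Equiv.swap_mul_self _ _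

theorem sT_mul_comm {a b : ℕ} (h : a + 1 < b) : sT a * sT b = sT b * sT a := by
  ext x
  simp only [sT, Equiv.Perm.mul_apply, Equiv.swap_apply_def]
  split_ifs <;> omega

/-- The strong exchange property for words in simple transpositions. -/
theorem exists_wordProd_mul_swap (l : List ℕ) {p q : ℕ} (hpq : p < q)
    (h : wordProd l q < wordProd l p) :
    ∃ l' : List ℕ, l'.length + 1 = l.length ∧ (∀ x ∈ l', x ∈ l) ∧
      wordProd l' = wordProd l * Equiv.swap p q := by
  induction l with
  | nil => simp [wordProd] at h; omega
  | cons b l ih =>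
    by_cases h' : wordProd l q < wordProd l p
    · obtain ⟨l', h1, h2, h3⟩ := ih h'
      refine ⟨b :: l', by simp [h1], by grind, ?_⟩
      rw [wordProd_cons, wordProd_cons, h3, mul_assoc]
    · have hne : wordProd l p ≠ wordProd l q := fun e => hpq.ne ((wordProd l).injective e)
      refine ⟨l, by simp, fun x hx => List.mem_cons_of_mem _ hx, ?_⟩
      rw [wordProd_cons] at h ⊢
      have hpb : wordProd l p = b ∧ wordProd l q = b + 1 := by
        simp only [sT, Equiv.Perm.mul_apply, Equiv.swap_apply_def] at h
        split_ifs at h <;> omega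
      rw [mul_assoc, Equiv.mul_swap_eq_swap_mul, hpb.1, hpb.2, ← mul_assoc]
      change _ = sT b * sT b * _
      rw [sT_mul_self, one_mul]

theorem IsReducedWord.length_le {w : Perm'} {l l' : List ℕ} (h : IsReducedWord w l)
    (h' : IsWord w l') : l.length ≤ l'.length := by
  rw [h.2]; exact Nat.sInf_le ⟨l', h', rfl⟩

theorem IsReducedWord.lt_of_append {w : Perm'} {α β : List ℕ} {a : ℕ}
    (h : IsReducedWord w (α ++ a :: β)) : wordProd α a < wordProd α (a + 1) := by
  by_contra hc
  have hne : wordProd α a ≠ wordProd α (a + 1) := fun e => by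
    have := (wordProd α).injective e; omega
  obtain ⟨l', h1, h2, h3⟩ := exists_wordProd_mul_swap α (Nat.lt_succ_self a) (by simp; omega)
  have := h.length_le (l' := l' ++ β) ⟨fun x hx => h.1.1 x (by grind), by
    rw [← h.1.2, wordProd_append, wordProd_append, h3, wordProd_cons, mul_assoc]; rfl⟩
  simp at this; omega

theorem IsReducedWord.inv_lt_of_append {w : Perm'} {α β : List ℕ} {a : ℕ}
    (h : IsReducedWord w (α ++ a :: β)) :
    (wordProd β)⁻¹ a < (wordProd β)⁻¹ (a + 1) := by
  by_contra hc
  have hne : (wordProd β)⁻¹ a ≠ (wordProd β)⁻¹ (a + 1) := fun e => by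
    have := (wordProd β)⁻¹.injective e; omega
  obtain ⟨l', h1, h2, h3⟩ := exists_wordProd_mul_swap β
    (p := (wordProd β)⁻¹ (a + 1)) (q := (wordProd β)⁻¹ a) (by omega) (by simp)
  have := h.length_le (l' := α ++ l') ⟨fun x hx => h.1.1 x (by grind), by
    rw [← h.1.2, wordProd_append, wordProd_append, h3, wordProd_cons,
      Equiv.mul_swap_eq_swap_mul, Equiv.swap_comm]
    simp [sT]⟩
  simp at this; omega

theorem IsReducedWord.not_square {w : Perm'} {α β : List ℕ} {a : ℕ} :
    ¬ IsReducedWord w (α ++ a :: a :: β) := by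
  intro h
  have := h.length_le (l' := α ++ β) ⟨fun x hx => h.1.1 x (by grind), by
    rw [← h.1.2, wordProd_append, wordProd_append, wordProd_cons, wordProd_cons, ← mul_assoc (sT a),
      sT_mul_self, one_mul]⟩
  simp at this

theorem IsReducedWord.comm {w : Perm'} {α β : List ℕ} {a b : ℕ} (hab : a + 1 < b ∨ b + 1 < a)
    (h : IsReducedWord w (α ++ a :: b :: β)) : IsReducedWord w (α ++ b :: a :: β) := by
  refine ⟨⟨fun x hx => h.1.1 x (by grind), ?_⟩, by rw [← h.2]; simp⟩
  rw [← h.1.2]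
  simp only [wordProd_append, wordProd_cons]
  rw [← mul_assoc (sT b), ← mul_assoc (sT a)]
  rcases hab with h | h <;> rw [sT_mul_comm h]

theorem exists_descent {w : Perm'} {p q : ℕ} (hp : 1 ≤ p) (hpq : p < q) (h : w q < w p) :
    ∃ k, p ≤ k ∧ k < q ∧ Descent w k := by
  induction q, hpq using Nat.le_induction with
  | base => exact ⟨p, le_rfl, by omega, hp, h⟩
  | succ q hq ih =>
    by_cases h' : w q < w p
    · obtain ⟨k, h1, h2, h3⟩ := ih h'
      exact ⟨k, h1, by omega, h3⟩
    · exact ⟨q, by omega, by omega, by omega, by omega⟩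

theorem IsReducedWord.not_braid {w : Perm'} (hG : Grassmannian w) {α β : List ℕ} {a : ℕ} :
    ¬ IsReducedWord w (α ++ a :: (a + 1) :: a :: β) := by
  intro h
  have h'' : IsReducedWord w ((α ++ [a, a + 1]) ++ a :: β) := by simpa using h
  have e1 : sT a a = a + 1 := by simp [sT]
  have e2 : sT a (a + 1) = a := by simp [sT]
  have e3 : sT a (a + 2) = a + 2 := by simp [sT, Equiv.swap_apply_def]
  have e4 : sT (a + 1) a = a := Equiv.swap_apply_of_ne_of_ne (by omega) (by omega)
  have e5 : sT (a + 1) (a + 1) = a + 2 := by simp [sT]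
  have e6 : sT (a + 1) (a + 2) = a + 1 := by simp [sT]
  have i (b : ℕ) : (sT b)⁻¹ = sT b := inv_eq_of_mul_eq_one_right (sT_mul_self b)
  have l1 := h.lt_of_append
  have l3 := h''.lt_of_append
  have r1 := h''.inv_lt_of_append
  have r3 := h.inv_lt_of_append
  simp only [wordProd_append, wordProd_cons, mul_inv_rev, Equiv.Perm.mul_apply, i, e1, e4, e5,
    show wordProd [] = 1 from rfl, Equiv.Perm.one_apply, e3] at l3 r3
  set A := wordProd α
  set B := wordProd β
  have hw : w = A * sT a * sT (a + 1) * sT a * B := by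
    rw [← h.1.2]; simp only [wordProd_append, wordProd_cons, mul_assoc, A, B]
  have w1 : w (B⁻¹ a) = A (a + 2) := by simp [hw, Equiv.Perm.mul_apply, e1, e5, e3]
  have w2 : w (B⁻¹ (a + 1)) = A (a + 1) := by simp [hw, Equiv.Perm.mul_apply, e1, e2, e4]
  have w3 : w (B⁻¹ (a + 2)) = A a := by simp [hw, Equiv.Perm.mul_apply, e2, e3, e6]
  have hp : 1 ≤ B⁻¹ a := by
    by_contra hc
    have : B⁻¹ a = 0 := by omega
    rw [this, hG.1.1] at w1
    omega
  obtain ⟨k, k1, k2, k3⟩ := exists_descent hp r1 (by omega : w _ < w _)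
  obtain ⟨m, m1, m2, m3⟩ := exists_descent (by omega) r3 (by omega : w _ < w _)
  have := hG.2 k3 m3
  omega

/-! ### Column insertion on finite sets -/

/-- The number of elements of `C` smaller than `t`. -/
def cnt (C : Finset ℕ) (t : ℕ) : ℕ := (C.filter (· < t)).card

theorem cnt_insert {C : Finset ℕ} {y : ℕ} (h : y ∉ C) (t : ℕ) :
    cnt (insert y C) t = cnt C t + if y < t then 1 else 0 := by
  unfold cnt
  rw [Finset.filter_insert]
  split_ifs
  · rw [Finset.card_insert_of_notMem (by simp [h])]
  · rfl

theorem cnt_erase {C : Finset ℕ} {e : ℕ} (h : e ∈ C) (t : ℕ) :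
    cnt (C.erase e) t + (if e < t then 1 else 0) = cnt C t := by
  conv_rhs => rw [← Finset.insert_erase h]
  rw [cnt_insert (Finset.notMem_erase e C)]

theorem cnt_mono (C : Finset ℕ) {s t : ℕ} (h : s ≤ t) : cnt C s ≤ cnt C t :=
  Finset.card_le_card (Finset.monotone_filter_right _ fun _ _ hx => lt_of_lt_of_le hx h)

theorem cnt_le_card (C : Finset ℕ) (t : ℕ) : cnt C t ≤ C.card := Finset.card_filter_le _ _

theorem cnt_eq_card {C : Finset ℕ} {t : ℕ} (h : ∀ c ∈ C, c < t) : cnt C t = C.card := by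
  unfold cnt; rw [Finset.filter_true_of_mem h]

theorem exists_of_cnt_lt {C : Finset ℕ} {s t : ℕ} (h : cnt C s < cnt C t) :
    ∃ c ∈ C, s ≤ c ∧ c < t := by
  by_contra hc
  push Not at hc
  refine absurd (Finset.card_le_card (s := C.filter (· < t)) (t := C.filter (· < s)) ?_)
    (not_le.2 h)
  intro c hm
  simp only [Finset.mem_filter] at hm ⊢
  exact ⟨hm.1, by by_contra h'; exact absurd (hc c hm.1 (by omega)) (by omega)⟩

theorem cnt_lt_of_mem {C : Finset ℕ} {c s t : ℕ} (hc : c ∈ C) (hs : s ≤ c) (ht : c < t) :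
    cnt C s < cnt C t := by
  have h1 := cnt_erase hc s
  have h2 := cnt_erase hc t
  have h3 := cnt_mono (C.erase c) (show s ≤ t by omega)
  rw [if_neg (by omega)] at h1
  rw [if_pos ht] at h2
  omega

/-- `ColStep C o D p`: inserting `o` (nothing if `o = none`) into the column with entry set `C`
gives the column `D` and bumps out `p`. -/
def ColStep (C : Finset ℕ) (o : Option ℕ) (D : Finset ℕ) (p : Option ℕ) : Prop :=
  (o = none ∧ D = C ∧ p = none) ∨
  ∃ y, o = some y ∧ y ∉ C ∧
    ((p = none ∧ D = insert y C ∧ ∀ c ∈ C, c < y) ∨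
     ∃ e ∈ C, p = some e ∧ y < e ∧ (∀ c ∈ C, y < c → e ≤ c) ∧ D = insert y (C.erase e))

theorem ColStep.mem_of_eq_some {C D : Finset ℕ} {o p : Option ℕ} {b : ℕ} (h : ColStep C o D p)
    (hb : p = some b) : b ∈ C := by
  unfold ColStep at h; grind

theorem ColStep.cnt_eq {C D : Finset ℕ} {o p : Option ℕ} (h : ColStep C o D p) (t : ℕ) :
    cnt D t + (if p.any (· < t) then 1 else 0) = cnt C t + (if o.any (· < t) then 1 else 0) := by
  rcases h with ⟨rfl, rfl, rfl⟩ | ⟨y, rfl, hy, ⟨rfl, rfl, -⟩ | ⟨e, he, rfl, hye, -, rfl⟩⟩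
  · simp
  · rw [cnt_insert hy]; simp
  · rw [cnt_insert (by simp [hy]), ← cnt_erase he t]; simp; omega

/-- Columns `C 0, C 1, …` with strictly increasing rows. -/
def Tab (C : ℕ → Finset ℕ) : Prop := ∀ j t, cnt (C (j + 1)) (t + 1) ≤ cnt (C j) t

theorem Tab.card_le {C : ℕ → Finset ℕ} (h : Tab C) (j : ℕ) : (C (j + 1)).card ≤ (C j).card := by
  rw [← cnt_eq_card (C := C (j + 1)) (t := (C (j + 1)).sup id + 1)
    fun c hc => Nat.lt_succ_of_le (Finset.le_sup (f := id) hc)]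
  exact (h j _).trans (cnt_le_card _ _)

theorem Tab.step {C D : ℕ → Finset ℕ} {o : ℕ → Option ℕ} (hC : Tab C)
    (h : ∀ j, ColStep (C j) (o j) (D j) (o (j + 1))) : Tab D := by
  intro j t
  have h0 := hC j t
  have hl := (h j).cnt_eq t
  have hr := (h (j + 1)).cnt_eq (t + 1)
  rcases h (j + 1) with ⟨e1, e2, e3⟩ | ⟨b, hb, hbC, hcase⟩
  · simp [e1] at hl; rw [e2]; omega
  have hbm := (h j).mem_of_eq_some hb
  have hmono : b < t → cnt (C (j + 1)) (t + 1) = cnt (C (j + 1)) (b + 1) →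
      cnt (C (j + 1)) (t + 1) < cnt (C j) t := fun hbt he => by
    have := hC j b
    have := cnt_lt_of_mem hbm le_rfl hbt
    omega
  have hgap : b < t → cnt (C (j + 1)) (t + 1) ≠ cnt (C (j + 1)) (b + 1) →
      ∃ d ∈ C (j + 1), b + 1 ≤ d ∧ d < t + 1 := fun hbt hne =>
    exists_of_cnt_lt (lt_of_le_of_ne (cnt_mono _ (by omega)) (Ne.symm hne))
  have hlt : ∀ y, o j = some y → y < b := by
    intro y hy
    rcases h j with ⟨e1, -⟩ | ⟨y', hy', -, ⟨e, -⟩ | ⟨e, -, he, hlt, -⟩⟩ <;> grind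
  have hsome : ∃ y, o j = some y := by
    rcases h j with ⟨-, -, e⟩ | ⟨y, hy, -⟩
    · simp [hb] at e
    · exact ⟨y, hy⟩
  obtain ⟨y, hy⟩ := hsome
  have hyb := hlt y hy
  simp only [hb, hy, Option.any_some, decide_eq_true_eq] at hl hr
  by_cases hbt : b < t
  · by_cases he : cnt (C (j + 1)) (t + 1) = cnt (C (j + 1)) (b + 1)
    · have := hmono hbt he
      split_ifs at hl hr <;> omega
    · obtain ⟨d, hd, hd1, hd2⟩ := hgap hbt he
      rcases hcase with ⟨-, -, hall⟩ | ⟨e, heC, hpe, -, hmin, -⟩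
      · have := hall d hd; omega
      · have := hmin d hd (by omega)
        simp only [hpe, Option.any_some, decide_eq_true_eq] at hr
        rw [if_pos (by omega), if_pos (by omega)] at hr
        split_ifs at hl <;> omega
  · split_ifs at hl hr <;> omega

/-! ### Comparing the insertions of a word with and without an additional first letter -/

/-- `C'` is obtained from `C` by exchanging the element `zi` for `zo ≤ zi`. -/
def Exch (C C' : Finset ℕ) (zi zo : ℕ) : Prop :=
  (zo = zi ∧ C' = C) ∨ (zo < zi ∧ zi ∈ C ∧ zo ∉ C ∧ C' = insert zo (C.erase zi))

/-- The letters `p` and `p'` bumped from a column and its companion either agree, or `p'` is the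
current difference letter `z` and `p` the next larger entry. -/
def OutRel (C D : Finset ℕ) (z : ℕ) (p p' : Option ℕ) : Prop :=
  (p = p' ∧ z ∉ D ∧ cnt D z = cnt C z) ∨
  ∃ c, p = some c ∧ p' = some z ∧ z < c ∧ c ∈ C ∧ cnt C c = cnt C z ∧ c ∉ D ∧
    cnt D c = cnt C z + 1

/-- The difference letter after bumping `p` and `p'`. -/
def newLetter (p p' : Option ℕ) (z : ℕ) : ℕ := if p = p' then z else p.getD 0

theorem cnt_eq_of_gap {C : Finset ℕ} {s t : ℕ} (hst : s ≤ t) (h : ∀ c ∈ C, s ≤ c → t ≤ c) :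
    cnt C t = cnt C s := by
  by_contra hne
  obtain ⟨c, hc, h1, h2⟩ := exists_of_cnt_lt (lt_of_le_of_ne (cnt_mono C hst) (Ne.symm hne))
  exact absurd (h c hc h1) (by omega)

/-- The column containing the additional cell. -/
theorem hole_column {C C' D D' : Finset ℕ} {o p p' : Option ℕ} {z : ℕ} (hz : z ∉ C)
    (hC' : C' = insert z C) (h : ColStep C o D p) (h' : ColStep C' o D' p') :
    (OutRel C D z p p' ∧ newLetter p p' z ∉ D ∧ D' = insert (newLetter p p' z) D) ∨
    (p = none ∧ p' = some z ∧ (∀ c ∈ C, c < z) ∧ D' = D ∧ o ≠ none) := by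
  subst hC'
  rcases h with ⟨rfl, rfl, rfl⟩ | ⟨y, rfl, hy, hcase⟩
  · rcases h' with ⟨-, rfl, rfl⟩ | ⟨y, hy, -⟩
    · left; simp [OutRel, newLetter, hz]
    · simp at hy
  rcases h' with ⟨h0, -⟩ | ⟨y', hyy, hy', hcase'⟩
  · simp at h0
  obtain rfl : y = y' := by simpa using hyy
  have hyz : y ≠ z := by rintro rfl; simp at hy'
  rcases hcase with ⟨rfl, rfl, hall⟩ | ⟨e, he, rfl, hye, hmin, rfl⟩
  · rcases hcase' with ⟨rfl, rfl, hall'⟩ | ⟨e', he', rfl, hye', hmin', rfl⟩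
    · left
      have := hall' z (by simp)
      refine ⟨Or.inl ⟨rfl, by simp [hz, hyz.symm], ?_⟩, ?_, ?_⟩
      · rw [cnt_insert hy, if_neg (by omega), add_zero]
      · simp [newLetter, hz, hyz.symm]
      · simp [newLetter, Finset.insert_comm]
    · right
      have hez : e' = z := by
        rcases Finset.mem_insert.1 he' with h | h
        · exact h
        · have := hall e' h; omega
      subst hez
      refine ⟨rfl, rfl, fun c hc => (hall c hc).trans hye', ?_, by simp⟩
      rw [Finset.erase_insert hz]
  · left
    rcases hcase' with ⟨rfl, rfl, hall'⟩ | ⟨e', he', rfl, hye', hmin', rfl⟩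
    · have := hall' e (by simp [he]); omega
    have hze : z ≠ e := by rintro rfl; exact hz he
    by_cases hlt : y < z ∧ z < e
    · have : e' = z := by
        have h1 := hmin' z (by simp) hlt.1
        rcases Finset.mem_insert.1 he' with h | h
        · exact h
        · have := hmin e' h hye'; omega
      subst this
      have hne : some e ≠ some e' := by simp; omega
      have hgap : cnt C e = cnt C e' := cnt_eq_of_gap (by omega) fun c hc h => hmin c hc (by omega)
      have hd := cnt_erase he e
      rw [if_neg (lt_irrefl _), add_zero] at hd
      have hy' : y ∉ C.erase e := by simp [hy]
      refine ⟨Or.inr ⟨e, rfl, rfl, hlt.2, he, hgap, by simp; omega, ?_⟩, ?_, ?_⟩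
      · rw [cnt_insert hy', if_pos hye]; omega
      · simp [newLetter, hne]; omega
      · simp only [newLetter, hne, if_false, Option.getD_some]
        rw [Finset.erase_insert hz, Finset.insert_comm, Finset.insert_erase he]
    · have : e' = e := by
        have h1 := hmin' e (by simp [he]) hye
        rcases Finset.mem_insert.1 he' with h | h
        · subst h; have := hmin' e (by simp [he]) hye; omega
        · have := hmin e' h hye'; omega
      subst this
      refine ⟨Or.inl ⟨rfl, by simp [hz, hyz.symm], ?_⟩, ?_, ?_⟩
      · have := cnt_erase he z
        rw [cnt_insert (by simp [hy])]
        split_ifs at this ⊢ <;> omega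
      · simp [newLetter, hz, hyz.symm]
      · simp only [newLetter, if_true]
        rw [Finset.erase_insert_of_ne hze, Finset.insert_comm]

/-- A column to the right of the additional cell, when the same letter is inserted in both. -/
theorem right_column_same {C C' D D' : Finset ℕ} {o p p' : Option ℕ} {zi zo : ℕ}
    (hE : Exch C C' zi zo) (hzo : zo ∉ C) (h : ColStep C o D p) (h' : ColStep C' o D' p')
    (hy : ∀ y, o = some y → y ≠ zi ∧
      (y < zi → (∃ c ∈ C, y < c ∧ c ≤ zi) ∧ cnt C' (y + 1) < cnt C (zi + 1))) :
    OutRel C D zo p p' ∧ Exch D D' zi (newLetter p p' zo) := by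
  rcases h with ⟨rfl, rfl, rfl⟩ | ⟨y, rfl, hyC, hcase⟩
  · rcases h' with ⟨-, rfl, rfl⟩ | ⟨y, hy, -⟩
    · simp [OutRel, newLetter, hzo, hE]
    · simp at hy
  rcases h' with ⟨h0, -⟩ | ⟨y', hyy, hyC', hcase'⟩
  · simp at h0
  obtain rfl : y = y' := by simpa using hyy
  obtain ⟨hyzi, hy2⟩ := hy y rfl
  rcases hE with ⟨rfl, rfl⟩ | ⟨hlt, hziC, -, rfl⟩
  · -- the two columns agree
    have hpp : p = p' ∧ D = D' := by
      rcases hcase with ⟨rfl, rfl, hall⟩ | ⟨e, he, rfl, hye, hmin, rfl⟩ <;>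
      rcases hcase' with ⟨rfl, rfl, hall'⟩ | ⟨e', he', rfl, hye', hmin', rfl⟩
      · simp
      · have := hall _ he'; omega
      · have := hall' _ he; omega
      · have : e = e' := le_antisymm (hmin _ he' hye') (hmin' _ he hye)
        simp [this]
    obtain ⟨rfl, rfl⟩ := hpp
    refine ⟨Or.inl ⟨rfl, ?_⟩, Or.inl ⟨by simp [newLetter], rfl⟩⟩
    rcases hcase with ⟨rfl, rfl, hall⟩ | ⟨e, he, rfl, hye, hmin, rfl⟩
    · refine ⟨by simp [hzo, hyzi.symm], ?_⟩
      rw [cnt_insert hyC, if_neg, add_zero]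
      intro hlt
      obtain ⟨⟨c, hc, h1, h2⟩, -⟩ := hy2 hlt
      have := hall c hc; omega
    · refine ⟨by simp [hzo, hyzi.symm], ?_⟩
      have hd := cnt_erase he zo
      have hez : e ≠ zo := by rintro rfl; exact hzo he
      rw [cnt_insert (by simp [hyC])]
      have : y < zo → e < zo := fun hlt => by
        obtain ⟨⟨c, hc, h1, h2⟩, -⟩ := hy2 hlt
        have := hmin c hc h1; omega
      split_ifs at hd ⊢ <;> omega
  · have hyzo : y ≠ zo := by rintro rfl; simp at hyC'
    have hcE := cnt_erase hziC (y + 1)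
    have hins := cnt_insert (C := C.erase zi) (y := zo) (by simp [hzo]) (y + 1)
    rcases hcase with ⟨rfl, rfl, hall⟩ | ⟨e, he, rfl, hye, hmin, rfl⟩
    · have h1 := hall zi hziC
      rcases hcase' with ⟨rfl, rfl, hall'⟩ | ⟨e', he', rfl, hye', hmin', rfl⟩
      · refine ⟨Or.inl ⟨rfl, by simp [hzo, hyzo.symm], ?_⟩, Or.inr ⟨by simpa [newLetter], ?_⟩⟩
        · rw [cnt_insert hyC, if_neg (by omega), add_zero]
        · refine ⟨by simp [hziC], by simp [newLetter, hzo, hyzo.symm], ?_⟩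
          simp only [newLetter, if_true]
          rw [Finset.insert_comm, Finset.erase_insert_of_ne hyzi]
      · have : e' < y := by
          rcases Finset.mem_insert.1 he' with h | h
          · omega
          · exact hall e' (Finset.mem_of_mem_erase h)
        omega
    · have hezo : e ≠ zo := by rintro rfl; exact hzo he
      have hkey : zo < y → e ≠ zi := by
        rintro hzoy rfl
        obtain ⟨-, hc⟩ := hy2 hye
        have := cnt_eq_of_gap (C := C) (s := y + 1) (t := e) hye fun c hc h => hmin c hc h
        have h2 := cnt_erase he (e + 1)
        have h3 := cnt_erase he e
        have h4 := cnt_eq_of_gap (C := C.erase e) (s := e) (t := e + 1) (by omega)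
          fun c hc h => by
            have := Finset.ne_of_mem_erase hc; omega
        simp at h2 h3
        rw [hins, if_pos (by omega)] at hc
        rw [if_neg (by omega)] at hcE
        omega
      rcases hcase' with ⟨rfl, rfl, hall'⟩ | ⟨e', he', rfl, hye', hmin', rfl⟩
      · by_contra
        have hezi : e = zi := by
          by_contra hne
          have := hall' e (by simp [hne, he]); omega
        exact hkey (hall' zo (by simp)) hezi
      · have hmem' : e' = zo ∨ (e' ≠ zi ∧ e' ∈ C) := by simpa using he'
        by_cases hyz : y < zo ∧ zo < e
        · have h1 := hmin' zo (by simp) hyz.1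
          have : e' = zo := by
            rcases hmem' with h | h
            · exact h
            · have := hmin e' h.2 hye'; omega
          subst this
          have hezi := hmin zi hziC (by omega)
          have hne : some e ≠ some e' := by simp; omega
          have hgap : cnt C e = cnt C e' :=
            cnt_eq_of_gap (by omega) fun c hc h => hmin c hc (by omega)
          have hd := cnt_erase he e
          rw [if_neg (lt_irrefl _), add_zero] at hd
          refine ⟨Or.inr ⟨e, rfl, rfl, hyz.2, he, hgap, by simp; omega, ?_⟩, ?_⟩
          · rw [cnt_insert (by simp [hyC]), if_pos hye]; omega
          · simp only [newLetter, hne, if_false, Option.getD_some]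
            rcases eq_or_lt_of_le hezi with rfl | hlt'
            · left
              refine ⟨rfl, ?_⟩
              rw [Finset.erase_insert (by simp [hzo])]
            · right
              refine ⟨hlt', by simp [hziC]; omega, by simp; omega, ?_⟩
              rw [Finset.erase_insert (by simp [hzo])]
              ext t
              simp only [Finset.mem_insert, Finset.mem_erase]
              grind
        · have hezi : e ≠ zi := fun h =>
            hkey (lt_of_le_of_ne (not_lt.1 fun h' => hyz ⟨h', by omega⟩) hyzo.symm) h
          have : e' = e := by
            have h1 := hmin' e (by simp [he, hezi]) hye
            rcases hmem' with h | h
            · omega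
            · have := hmin e' h.2 hye'; omega
          subst this
          refine ⟨Or.inl ⟨rfl, by simp [hzo, hyzo.symm], ?_⟩, Or.inr ⟨by simpa [newLetter], ?_⟩⟩
          · have hd := cnt_erase he zo
            rw [cnt_insert (by simp [hyC])]
            split_ifs at hd ⊢ <;> omega
          · refine ⟨by simp [hziC]; omega, by simp [newLetter, hzo, hyzo.symm], ?_⟩
            simp only [newLetter, if_true]
            ext t
            simp only [Finset.mem_insert, Finset.mem_erase]
            grind

/-- A column to the right of the additional cell, when `c` is inserted in the column and `zi` in
its companion. -/
theorem right_column_exch {C C' D D' : Finset ℕ} {p p' : Option ℕ} {zi zo c : ℕ}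
    (hE : Exch C C' zi zo) (hzo : zo ∉ C) (hc : zi < c) (hgap : ∀ e ∈ C, zi < e → c < e)
    (h : ColStep C (some c) D p) (h' : ColStep C' (some zi) D' p') :
    OutRel C D zo p p' ∧ p = p' ∧ Exch D D' c zo := by
  rcases h with ⟨h0, -⟩ | ⟨c', hcc, hcC, hcase⟩
  · simp at h0
  obtain rfl : c = c' := by simpa using hcc
  rcases h' with ⟨h0, -⟩ | ⟨y, hyy, hyC', hcase'⟩
  · simp at h0
  obtain rfl : zi = y := by simpa using hyy
  have hle : zo ≤ zi := by rcases hE with ⟨h, -⟩ | ⟨h, -⟩ <;> omega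
  have hmem : ∀ e, zi < e → (e ∈ C' ↔ e ∈ C) := by
    intro e he
    rcases hE with ⟨rfl, rfl⟩ | ⟨hlt, hziC, -, rfl⟩
    · rfl
    · simp only [Finset.mem_insert, Finset.mem_erase]; grind
  have hpp : p = p' := by
    rcases hcase with ⟨rfl, rfl, hall⟩ | ⟨e, he, rfl, hye, hmin, rfl⟩ <;>
    rcases hcase' with ⟨rfl, rfl, hall'⟩ | ⟨e', he', rfl, hye', hmin', rfl⟩
    · rfl
    · have := hall e' ((hmem e' hye').1 he')
      have := hgap e' ((hmem e' hye').1 he') hye'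
      omega
    · have := hall' e ((hmem e (by omega)).2 he); omega
    · have h1 := (hmem e' hye').1 he'
      rw [le_antisymm (hmin e' h1 (hgap e' h1 hye')) (hmin' e ((hmem e (by omega)).2 he) (by omega))]
  subst hpp
  have hcnt : zo ∉ D ∧ cnt D zo = cnt C zo := by
    rcases hcase with ⟨rfl, rfl, hall⟩ | ⟨e, he, rfl, hye, hmin, rfl⟩
    · refine ⟨by simp [hzo]; omega, ?_⟩
      rw [cnt_insert hcC, if_neg (by omega), add_zero]
    · refine ⟨by simp [hzo]; omega, ?_⟩
      have := cnt_erase he zo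
      rw [cnt_insert (by simp [hcC])]
      split_ifs at this ⊢ <;> omega
  refine ⟨Or.inl ⟨rfl, hcnt⟩, rfl, Or.inr ⟨by omega, ?_, hcnt.1, ?_⟩⟩
  · rcases hcase with ⟨rfl, rfl, hall⟩ | ⟨e, he, rfl, hye, hmin, rfl⟩ <;> simp
  · rcases hE with ⟨rfl, rfl⟩ | ⟨hlt, hziC, -, rfl⟩ <;>
    rcases hcase with ⟨rfl, rfl, hall⟩ | ⟨e, he, rfl, hye, hmin, rfl⟩ <;>
    rcases hcase' with ⟨h1, rfl, hall'⟩ | ⟨e', he', h1, hye', hmin', rfl⟩ <;>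
    simp at h1 <;> ext t <;> simp only [Finset.mem_insert, Finset.mem_erase] <;> grind

theorem ColStep.unique {C D D' : Finset ℕ} {o p p' : Option ℕ} (h : ColStep C o D p)
    (h' : ColStep C o D' p') : D' = D ∧ p' = p := by
  rcases h with ⟨rfl, rfl, rfl⟩ | ⟨y, rfl, hy, hcase⟩ <;>
  rcases h' with ⟨h0, rfl, rfl⟩ | ⟨y', hyy, hy', hcase'⟩
  · simp
  · simp at hyy
  · simp at h0
  obtain rfl : y = y' := by simpa using hyy
  rcases hcase with ⟨rfl, rfl, hall⟩ | ⟨e, he, rfl, hye, hmin, rfl⟩ <;>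
  rcases hcase' with ⟨rfl, rfl, hall'⟩ | ⟨e', he', rfl, hye', hmin', rfl⟩
  · simp
  · have := hall _ he'; omega
  · have := hall' _ he; omega
  · have : e = e' := le_antisymm (hmin _ he' hye') (hmin' _ he hye)
    simp [this]

theorem ColStep.out_none {C D : Finset ℕ} {p : Option ℕ} (h : ColStep C none D p) :
    D = C ∧ p = none := by
  rcases h with ⟨-, h1, h2⟩ | ⟨y, hy, -⟩
  · exact ⟨h1, h2⟩
  · simp at hy

theorem ColStep.lt_out {C D : Finset ℕ} {y d : ℕ} (h : ColStep C (some y) D (some d)) : y < d := by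
  unfold ColStep at h; grind

/-- The tableau with columns `C'` arises from the one with columns `C` by an insertion from the
left, which adds a cell in column `h`; the letter `z (j + 1)` moves from column `j + 1` to
column `j`. -/
structure PairInv (C C' : ℕ → Finset ℕ) (h : ℕ) (z : ℕ → ℕ) : Prop where
  left : ∀ j < h, C' j = C j
  hole : C' h = insert (z (h + 1)) (C h)
  right : ∀ j, h < j → Exch (C j) (C' j) (z j) (z (j + 1))
  notMem : ∀ j, h ≤ j → z (j + 1) ∉ C j
  rank : ∀ j, h ≤ j → cnt (C j) (z (j + 1)) = cnt (C (j + 1)) (z (j + 1) + 1)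

theorem PairInv.cnt_eq {C C' : ℕ → Finset ℕ} {h : ℕ} {z : ℕ → ℕ} (H : PairInv C C' h z) {j t : ℕ}
    (hj : h ≤ j) (ht : t ≤ z (j + 1)) : cnt (C' j) t = cnt (C j) t := by
  have hn := H.notMem j hj
  rcases eq_or_lt_of_le hj with rfl | hj
  · rw [H.hole, cnt_insert hn, if_neg (by omega), add_zero]
  · rcases H.right j hj with ⟨-, e⟩ | ⟨hlt, hm, -, e⟩
    · rw [e]
    · rw [e, cnt_insert (by simp [hn]), ← cnt_erase hm, if_neg (by omega), if_neg (by omega)]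

section Step

variable {C C' D D' : ℕ → Finset ℕ} {h : ℕ} {z : ℕ → ℕ} {o o' : ℕ → Option ℕ}

theorem PairInv.next_column (H : PairInv C C' h z) (hC : Tab C) (hC' : Tab C')
    (hs : ∀ j, ColStep (C j) (o j) (D j) (o (j + 1)))
    (hs' : ∀ j, ColStep (C' j) (o' j) (D' j) (o' (j + 1))) {j : ℕ} (hj : h ≤ j)
    (hout : OutRel (C j) (D j) (z (j + 1)) (o (j + 1)) (o' (j + 1))) :
    OutRel (C (j + 1)) (D (j + 1)) (z (j + 2)) (o (j + 2)) (o' (j + 2)) ∧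
    Exch (D (j + 1)) (D' (j + 1)) (newLetter (o (j + 1)) (o' (j + 1)) (z (j + 1)))
      (newLetter (o (j + 2)) (o' (j + 2)) (z (j + 2))) := by
  have hE := H.right (j + 1) (by omega)
  have hn := H.notMem (j + 1) (by omega)
  have hr := H.rank j hj
  rcases hout with ⟨heq, -, -⟩ | ⟨c, hc, hc', hlt, hcC, hcnt, -, -⟩
  · have hs1 := hs' (j + 1)
    rw [← heq] at hs1
    have hnl : newLetter (o (j + 1)) (o' (j + 1)) (z (j + 1)) = z (j + 1) := by
      simp [newLetter, heq]
    rw [hnl]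
    refine right_column_same hE hn (hs (j + 1)) hs1 fun y hy => ?_
    have hyC := (hs j).mem_of_eq_some hy
    refine ⟨fun e => H.notMem j hj (e ▸ hyC), fun hyz => ?_⟩
    have h1 := cnt_lt_of_mem hyC le_rfl hyz
    have h2 := hC j y
    have h3 := hC' j y
    rw [H.cnt_eq hj hyz.le] at h3
    refine ⟨?_, by omega⟩
    obtain ⟨e, he, he1, he2⟩ :=
      exists_of_cnt_lt (show cnt (C (j + 1)) (y + 1) < cnt (C (j + 1)) (z (j + 1) + 1) by omega)
    exact ⟨e, he, by omega, by omega⟩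
  · have hne : o (j + 1) ≠ o' (j + 1) := by rw [hc, hc']; simp; omega
    have hnl : newLetter (o (j + 1)) (o' (j + 1)) (z (j + 1)) = c := by
      rw [newLetter, if_neg hne, hc]; rfl
    have hs0 := hs (j + 1)
    have hs1 := hs' (j + 1)
    rw [hc] at hs0
    rw [hc'] at hs1
    have hgap : ∀ e ∈ C (j + 1), z (j + 1) < e → c < e := by
      intro e he h1
      by_contra h2
      have h3 := cnt_lt_of_mem (s := z (j + 1) + 1) (t := c + 1) he h1 (by omega)
      have h4 := hC j c
      omega
    obtain ⟨h1, h2, h3⟩ := right_column_exch hE hn hlt hgap hs0 hs1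
    refine ⟨h1, ?_⟩
    rw [hnl]
    simpa [newLetter, h2] using h3

theorem PairInv.new_rank (H : PairInv C C' h z) (hC : Tab C)
    (hs : ∀ j, ColStep (C j) (o j) (D j) (o (j + 1))) {j : ℕ} (hj : h ≤ j)
    (hout : OutRel (C j) (D j) (z (j + 1)) (o (j + 1)) (o' (j + 1))) :
    newLetter (o (j + 1)) (o' (j + 1)) (z (j + 1)) ∉ D j ∧
    cnt (D j) (newLetter (o (j + 1)) (o' (j + 1)) (z (j + 1))) =
      cnt (D (j + 1)) (newLetter (o (j + 1)) (o' (j + 1)) (z (j + 1)) + 1) := by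
  have hr := H.rank j hj
  have hn := H.notMem j hj
  rcases hout with ⟨heq, hD, hcD⟩ | ⟨c, hc, hc', hlt, hcC, hcnt, hcn, hcD⟩
  · have hnl : newLetter (o (j + 1)) (o' (j + 1)) (z (j + 1)) = z (j + 1) := by
      simp [newLetter, heq]
    rw [hnl]
    refine ⟨hD, ?_⟩
    have hq := (hs (j + 1)).cnt_eq (z (j + 1) + 1)
    rcases hb : o (j + 1) with _ | b
    · have hst := hs (j + 1)
      rw [hb] at hst
      rw [hst.out_none.1]; omega
    · have hbC := (hs j).mem_of_eq_some hb
      have hbz : b ≠ z (j + 1) := fun e => hn (e ▸ hbC)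
      have hst := hs (j + 1)
      rw [hb] at hst hq
      rcases hd : o (j + 2) with _ | d
      · rw [hd] at hq hst
        have : ¬ b < z (j + 1) := fun hlt => by
          have h1 := cnt_lt_of_mem hbC le_rfl hlt
          have h2 := hC j b
          obtain ⟨e, he, he1, he2⟩ := exists_of_cnt_lt
            (show cnt (C (j + 1)) (b + 1) < cnt (C (j + 1)) (z (j + 1) + 1) by omega)
          rcases hst with ⟨h0, -⟩ | ⟨y, hy, -, ⟨-, -, hall⟩ | ⟨e, -, h0, -⟩⟩
          · simp at h0
          · have := hall e he
            simp at hy; omega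
          · simp at h0
        simp only [Option.any_none, Option.any_some, decide_eq_true_eq, Bool.false_eq_true,
          if_false] at hq
        rw [if_neg (by omega)] at hq
        omega
      · rw [hd] at hq hst
        have hbd := hst.lt_out
        have : b < z (j + 1) → d ≤ z (j + 1) := fun hlt => by
          have h1 := cnt_lt_of_mem hbC le_rfl hlt
          have h2 := hC j b
          obtain ⟨e, he, he1, he2⟩ := exists_of_cnt_lt
            (show cnt (C (j + 1)) (b + 1) < cnt (C (j + 1)) (z (j + 1) + 1) by omega)
          rcases hst with ⟨h0, -⟩ | ⟨y, hy, -, ⟨h0, -⟩ | ⟨e', -, h0, -, hmin, -⟩⟩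
          · simp at h0
          · simp at h0
          · simp at hy h0
            have := hmin e he (by omega)
            omega
        simp only [Option.any_some, decide_eq_true_eq] at hq
        split_ifs at hq <;> omega
  · have hne : o (j + 1) ≠ o' (j + 1) := by rw [hc, hc']; simp; omega
    have hnl : newLetter (o (j + 1)) (o' (j + 1)) (z (j + 1)) = c := by
      rw [newLetter, if_neg hne, hc]; rfl
    rw [hnl]
    refine ⟨hcn, ?_⟩
    have hq := (hs (j + 1)).cnt_eq (c + 1)
    have hst := hs (j + 1)
    rw [hc] at hq hst
    have h1 : (o (j + 2)).any (fun x => decide (x < c + 1)) = false := by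
      rcases hd : o (j + 2) with _ | d
      · rfl
      · rw [hd] at hst
        have := hst.lt_out
        simp; omega
    have h2 := hC j c
    have h3 := cnt_mono (C (j + 1)) (show z (j + 1) + 1 ≤ c + 1 by omega)
    have h1' : (o (j + 1 + 1)).any (fun x => decide (x < c + 1)) = false := h1
    simp only [h1', Option.any_some, decide_eq_true_eq, Bool.false_eq_true, if_false,
      add_zero] at hq
    rw [if_pos (by omega)] at hq
    omega

theorem PairInv.step (H : PairInv C C' h z) (hC : Tab C) (hC' : Tab C')
    (hs : ∀ j, ColStep (C j) (o j) (D j) (o (j + 1)))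
    (hs' : ∀ j, ColStep (C' j) (o' j) (D' j) (o' (j + 1))) (h0 : o 0 = o' 0) :
    ∃ h' z', PairInv D D' h' z' ∧
      ((h' = h ∧ ∀ j, o j = none ↔ o' j = none) ∨
       (h' = h + 1 ∧ o h ≠ none ∧ o (h + 1) = none ∧ o' (h + 1) ≠ none ∧ o' (h + 2) = none ∧
        (C h).card = (C (h + 1)).card)) := by
  have hleft : ∀ j ≤ h, o j = o' j := by
    intro j hj
    induction j with
    | zero => exact h0
    | succ j ih =>
      have h1 := hs' j
      rw [← ih (by omega), H.left j (by omega)] at h1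
      exact ((hs j).unique h1).2.symm
  have hleftD : ∀ j < h, D' j = D j := by
    intro j hj
    have h1 := hs' j
    rw [← hleft j hj.le, H.left j hj] at h1
    exact ((hs j).unique h1).1
  have hh := hs' h
  rw [← hleft h le_rfl] at hh
  rcases hole_column (H.notMem h le_rfl) H.hole (hs h) hh with ⟨hout, -, hD⟩ | ⟨e1, e2, hall, hD, e3⟩
  · have hall : ∀ j, h ≤ j → OutRel (C j) (D j) (z (j + 1)) (o (j + 1)) (o' (j + 1)) := by
      intro j hj
      induction j, hj using Nat.le_induction with
      | base => exact hout
      | succ j hj ih => exact (H.next_column hC hC' hs hs' hj ih).1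
    refine ⟨h, fun j => newLetter (o j) (o' j) (z j), ⟨hleftD, hD, ?_, ?_, ?_⟩, Or.inl ⟨rfl, ?_⟩⟩
    · intro j hj
      obtain ⟨i, rfl⟩ : ∃ i, j = i + 1 := ⟨j - 1, by omega⟩
      exact (H.next_column hC hC' hs hs' (by omega) (hall i (by omega))).2
    · exact fun j hj => (H.new_rank hC hs hj (hall j hj)).1
    · exact fun j hj => (H.new_rank hC hs hj (hall j hj)).2
    · intro j
      rcases le_or_gt j h with hj | hj
      · rw [hleft j hj]
      · obtain ⟨i, rfl⟩ : ∃ i, j = i + 1 := ⟨j - 1, by omega⟩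
        rcases hall i (by omega) with ⟨e, -⟩ | ⟨c, e, e', -⟩
        · rw [e]
        · simp [e, e']
  · have hr := H.rank h le_rfl
    have hcard := cnt_eq_card hall
    have hge : ∀ e ∈ C (h + 1), e ≤ z (h + 1) := by
      intro e he
      by_contra hlt
      have h1 := cnt_lt_of_mem (s := z (h + 1) + 1) (t := e + 1) he (by omega) (by omega)
      have h2 := hC h e
      have h3 := cnt_le_card (C h) e
      omega
    have hEx := H.right (h + 1) (by omega)
    have hge' : ∀ e ∈ C' (h + 1), e ≤ z (h + 1) := by
      intro e he
      rcases hEx with ⟨-, e1⟩ | ⟨hlt, -, -, e1⟩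
      · exact hge e (e1 ▸ he)
      · rw [e1] at he
        rcases Finset.mem_insert.1 he with rfl | he
        · exact hlt.le
        · exact hge e (Finset.mem_of_mem_erase he)
    have hs1 := hs' (h + 1)
    rw [e2] at hs1
    have hD1 : o' (h + 2) = none ∧ D' (h + 1) = insert (z (h + 1)) (C' (h + 1)) := by
      rcases hs1 with ⟨h0, -⟩ | ⟨y, hy, -, ⟨hp, hD, -⟩ | ⟨e, he, -, hlt, -⟩⟩
      · simp at h0
      · simp at hy; subst hy; exact ⟨hp, hD⟩
      · simp at hy
        have := hge' e he; omega
    have hnone : ∀ j, h + 1 ≤ j → o j = none ∧ o' (j + 1) = none := by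
      intro j hj
      induction j, hj using Nat.le_induction with
      | base => exact ⟨e1, hD1.1⟩
      | succ j hj ih =>
        have h1 := hs j
        have h2 := hs' (j + 1)
        rw [ih.1] at h1
        rw [ih.2] at h2
        exact ⟨h1.out_none.2, h2.out_none.2⟩
    have hDC : ∀ j, h + 1 ≤ j → D j = C j := fun j hj => by
      have h1 := hs j
      rw [(hnone j hj).1] at h1
      exact h1.out_none.1
    have hDC' : ∀ j, h + 2 ≤ j → D' j = C' j := fun j hj => by
      obtain ⟨i, rfl⟩ : ∃ i, j = i + 1 := ⟨j - 1, by omega⟩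
      have h1 := hs' (i + 1)
      rw [(hnone i (by omega)).2] at h1
      exact h1.out_none.1
    refine ⟨h + 1, z, ⟨?_, ?_, ?_, ?_, ?_⟩, Or.inr ⟨rfl, e3, e1, by simp [e2], hD1.1, ?_⟩⟩
    · intro j hj
      rcases eq_or_lt_of_le (Nat.lt_succ_iff.1 hj) with rfl | hj
      · exact hD
      · exact hleftD j hj
    · rw [hD1.2, hDC _ le_rfl]
      rcases hEx with ⟨e, e'⟩ | ⟨-, hm, -, e'⟩
      · rw [e', ← e]
      · rw [e', Finset.insert_comm, Finset.insert_erase hm]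
    · intro j hj
      rw [hDC j (by omega), hDC' j (by omega)]
      exact H.right j (by omega)
    · intro j hj
      rw [hDC j hj]
      exact H.notMem j (by omega)
    · intro j hj
      rw [hDC j hj, hDC (j + 1) (by omega)]
      exact H.rank j (by omega)
    · have h1 := cnt_le_card (C (h + 1)) (z (h + 1) + 1)
      have h2 := hC.card_le h
      omega

end Step

/-! ### Edelman–Greene insertion of reduced words of Grassmannian permutations -/

theorem IsReducedWord.move_left {w : Perm'} {y : ℕ} {β : List ℕ} :
    ∀ {L α : List ℕ}, (∀ d ∈ L, d + 1 < y ∨ y + 1 < d) →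
      IsReducedWord w (α ++ (L ++ y :: β)) → IsReducedWord w (α ++ y :: (L ++ β))
  | [], _, _, h => h
  | d :: L, α, hL, h => by
    have h1 : IsReducedWord w ((α ++ [d]) ++ (L ++ y :: β)) := by simpa using h
    have h2 := IsReducedWord.move_left (fun d' hd' => hL d' (by simp [hd'])) h1
    have h3 : IsReducedWord w (α ++ d :: y :: (L ++ β)) := by simpa using h2
    exact h3.comm (hL d (by simp))

theorem IsReducedWord.notMem_column {w : Perm'} (hG : Grassmannian w) {y : ℕ} {α β C : List ℕ}
    (hC : C.Pairwise (· < ·)) (h : IsReducedWord w (α ++ (C ++ y :: β))) : y ∉ C := by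
  intro hy
  obtain ⟨L, R, rfl⟩ := List.append_of_mem hy
  have hR : ∀ d ∈ R, y < d := by
    have := (List.pairwise_append.1 hC).2.1
    exact (List.pairwise_cons.1 this).1
  have hRs : R.Pairwise (· < ·) := (List.pairwise_cons.1 (List.pairwise_append.1 hC).2.1).2
  by_cases hmem : y + 1 ∈ R
  · cases R with
    | nil => simp at hmem
    | cons b R =>
      have hb : b = y + 1 := by
        have h1 := hR b (by simp)
        rcases List.mem_cons.1 hmem with h | h
        · exact h.symm
        · have := (List.pairwise_cons.1 hRs).1 _ h; omega
      subst hb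
      have h1 : IsReducedWord w ((α ++ L ++ [y, y + 1]) ++ (R ++ y :: β)) := by simpa using h
      have h2 := IsReducedWord.move_left (fun d hd => by
        have := (List.pairwise_cons.1 hRs).1 d hd; omega) h1
      have h3 : IsReducedWord w ((α ++ L) ++ y :: (y + 1) :: y :: (R ++ β)) := by simpa using h2
      exact IsReducedWord.not_braid hG h3
  · have h1 : IsReducedWord w ((α ++ L ++ [y]) ++ (R ++ y :: β)) := by simpa using h
    have h2 := IsReducedWord.move_left (fun d hd => by
      have := hR d hd
      have : d ≠ y + 1 := fun e => hmem (e ▸ hd)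
      omega) h1
    have h3 : IsReducedWord w ((α ++ L) ++ y :: y :: (R ++ β)) := by simpa using h2
    exact h3.not_square

theorem colIns_spec {w : Perm'} (hG : Grassmannian w) {y : ℕ} {α β C : List ℕ}
    (hC : C.Pairwise (· < ·)) (h : IsReducedWord w (α ++ (C ++ y :: β))) :
    (colIns y C).1.Pairwise (· < ·) ∧
    ColStep C.toFinset (some y) (colIns y C).1.toFinset (colIns y C).2 ∧
    IsReducedWord w (α ++ ((colIns y C).2.toList ++ ((colIns y C).1 ++ β))) := by
  have hy := h.notMem_column hG hC
  unfold colIns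
  by_cases hall : ∀ c ∈ C, c < y
  · rw [if_pos (by simpa using hall)]
    refine ⟨?_, Or.inr ⟨y, rfl, by simpa using hy, Or.inl ⟨rfl, ?_, by simpa using hall⟩⟩, ?_⟩
    · exact List.pairwise_append.2 ⟨hC, by simp, by simpa using hall⟩
    · ext; simp
    · simpa using h
  · rw [if_neg (by simpa using hall), if_neg (fun h => hy h.1)]
    have hex : ∃ c ∈ C, y < c := by
      push Not at hall
      obtain ⟨c, hc, hle⟩ := hall
      exact ⟨c, hc, lt_of_le_of_ne hle fun e => hy (e ▸ hc)⟩
    rcases hf : C.find? (fun c => decide (y < c)) with _ | e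
    · rw [List.find?_eq_none] at hf
      obtain ⟨c, hc, hlt⟩ := hex
      exact absurd hlt (by simpa using hf c hc)
    obtain ⟨hye, L, R, rfl, hL⟩ := List.find?_eq_some_iff_append.1 hf
    have hye : y < e := by simpa using hye
    have hL : ∀ l ∈ L, l < y := by
      intro l hl
      have h1 : l ≤ y := by simpa using hL l hl
      exact lt_of_le_of_ne h1 fun e => hy (by simp [← e, hl])
    obtain ⟨hLs, hRs, -⟩ := List.pairwise_append.1 hC
    obtain ⟨hR, hRs⟩ := List.pairwise_cons.1 hRs
    have hmap : (L ++ e :: R).map (fun c => if c = e then y else c) = L ++ y :: R := by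
      rw [List.map_append, List.map_cons, if_pos rfl]
      congr 1
      · conv_rhs => rw [← List.map_id L]
        refine List.map_congr_left fun l hl => ?_
        have := hL l hl
        rw [if_neg (by omega)]; rfl
      · congr 1
        conv_rhs => rw [← List.map_id R]
        refine List.map_congr_left fun l hl => ?_
        have := hR l hl
        rw [if_neg (by omega)]; rfl
    simp only [hmap]
    refine ⟨?_, Or.inr ⟨y, rfl, mt List.mem_toFinset.1 hy, Or.inr ⟨e, by simp, rfl, hye, ?_, ?_⟩⟩, ?_⟩
    · refine List.pairwise_append.2 ⟨hLs, List.pairwise_cons.2 ⟨fun r hr => ?_, hRs⟩, ?_⟩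
      · have := hR r hr; omega
      · intro l hl r hr
        have := hL l hl
        rcases List.mem_cons.1 hr with rfl | hr
        · exact this
        · have := hR r hr; omega
    · intro c hc hlt
      simp only [List.mem_toFinset, List.mem_append, List.mem_cons] at hc
      rcases hc with hc | rfl | hc
      · have := hL c hc; omega
      · exact le_rfl
      · exact (hR c hc).le
    · ext t
      simp only [List.mem_toFinset, List.mem_append, List.mem_cons, Finset.mem_insert,
        Finset.mem_erase]
      have h1 : t ∈ L → t < y := hL t
      have h2 : t ∈ R → e < t := hR t
      constructor
      · rintro (ht | rfl | ht)
        · exact Or.inr ⟨by have := h1 ht; omega, Or.inl ht⟩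
        · exact Or.inl rfl
        · exact Or.inr ⟨by have := h2 ht; omega, Or.inr (Or.inr ht)⟩
      · rintro (rfl | ⟨hne, ht | rfl | ht⟩)
        · exact Or.inr (Or.inl rfl)
        · exact Or.inl ht
        · exact absurd rfl hne
        · exact Or.inr (Or.inr ht)
    · have h1 : IsReducedWord w ((α ++ L ++ [e]) ++ (R ++ y :: β)) := by simpa using h
      have h2 := IsReducedWord.move_left (fun d hd => by have := hR d hd; omega) h1
      have h3 : IsReducedWord w (α ++ (L ++ e :: (y :: (R ++ β)))) := by simpa using h2
      have h4 := IsReducedWord.move_left (fun d hd => by have := hL d hd; omega) h3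
      simpa using h4

/-- The columns of a tableau, read from right to left. -/
def columnWord : List (List ℕ) → List ℕ
  | [] => []
  | C :: rest => columnWord rest ++ C

/-- The set of entries of column `j`. -/
def colSet (T : List (List ℕ)) (j : ℕ) : Finset ℕ := (T.getD j []).toFinset

theorem egInsert_spec {w : Perm'} (hG : Grassmannian w) {α : List ℕ} :
    ∀ {T : List (List ℕ)} {y : ℕ} {β : List ℕ}, (∀ C ∈ T, C.Pairwise (· < ·)) →
      IsReducedWord w (α ++ (columnWord T ++ y :: β)) →
      (∀ C ∈ (egInsert T y).1, C.Pairwise (· < ·)) ∧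
      IsReducedWord w (α ++ (columnWord (egInsert T y).1 ++ β)) ∧
      (egInsert T y).2 ≤ T.length ∧
      (egInsert T y).1.length = max T.length ((egInsert T y).2 + 1) ∧
      ∃ o : ℕ → Option ℕ, o 0 = some y ∧
        (∀ j, ColStep (colSet T j) (o j) (colSet (egInsert T y).1 j) (o (j + 1))) ∧
        o (egInsert T y).2 ≠ none ∧ o ((egInsert T y).2 + 1) = none
  | [], y, β, _, h => by
    refine ⟨by simp [egInsert], by simpa [egInsert, columnWord] using h, by simp [egInsert],
      by simp [egInsert], fun j => if j = 0 then some y else none, rfl, ?_, by simp [egInsert],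
      by simp [egInsert]⟩
    intro j
    cases j with
    | zero => exact Or.inr ⟨y, rfl, by simp [colSet], Or.inl ⟨rfl, by simp [colSet, egInsert],
        by simp [colSet]⟩⟩
    | succ j => exact Or.inl ⟨by simp, by simp [colSet, egInsert], by simp⟩
  | C :: T, y, β, hs, h => by
    have h1 : IsReducedWord w ((α ++ columnWord T) ++ (C ++ y :: β)) := by
      simpa [columnWord] using h
    obtain ⟨c1, c2, c3⟩ := colIns_spec hG (hs C (by simp)) h1
    have hsT : ∀ C ∈ T, C.Pairwise (· < ·) := fun C' hC' => hs C' (by simp [hC'])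
    rcases hc : colIns y C with ⟨D, _ | e⟩
    · rw [hc] at c1 c2 c3
      have heq : egInsert (C :: T) y = (D :: T, 0) := by simp [egInsert, hc]
      rw [heq]
      refine ⟨?_, by simpa [columnWord] using c3, by simp, by simp,
        fun j => if j = 0 then some y else none, rfl, ?_, by simp, by simp⟩
      · intro C' hC'
        rcases List.mem_cons.1 hC' with rfl | hC'
        · exact c1
        · exact hsT _ hC'
      · intro j
        cases j with
        | zero => simpa [colSet] using c2
        | succ j => exact Or.inl ⟨by simp, by simp [colSet], by simp⟩
    · rw [hc] at c1 c2 c3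
      have h2 : IsReducedWord w (α ++ (columnWord T ++ e :: (D ++ β))) := by simpa using c3
      obtain ⟨d1, d2, d3, d4, o, d5, d6, d7, d8⟩ := egInsert_spec hG hsT h2
      have heq : egInsert (C :: T) y = (D :: (egInsert T e).1, (egInsert T e).2 + 1) := by
        simp [egInsert, hc]
      rw [heq]
      refine ⟨?_, by simpa [columnWord] using d2, by simpa using d3, ?_,
        fun j => if j = 0 then some y else o (j - 1), rfl, ?_, by simpa using d7, by simpa using d8⟩
      · intro C' hC'
        rcases List.mem_cons.1 hC' with rfl | hC'
        · exact c1
        · exact d1 _ hC'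
      · simp only [List.length_cons, d4]; omega
      · intro j
        cases j with
        | zero => simpa [colSet, d5] using c2
        | succ j => simpa [colSet] using d6 j

section Stream

variable {C D E : ℕ → Finset ℕ} {o p : ℕ → Option ℕ}

theorem none_of_le (hs : ∀ j, ColStep (C j) (o j) (D j) (o (j + 1))) {i j : ℕ} (hi : o i = none)
    (hij : i ≤ j) : o j = none := by
  induction j, hij using Nat.le_induction with
  | base => exact hi
  | succ j _ ih =>
    have := hs j
    rw [ih] at this
    exact this.out_none.2

theorem ColStep.card_eq {C D : Finset ℕ} {o p : Option ℕ} (h : ColStep C o D p) :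
    D.card = C.card + if o ≠ none ∧ p = none then 1 else 0 := by
  rcases h with ⟨rfl, rfl, rfl⟩ | ⟨y, rfl, hy, ⟨rfl, rfl, -⟩ | ⟨e, he, rfl, hye, -, rfl⟩⟩
  · simp
  · simp [Finset.card_insert_of_notMem hy]
  · rw [Finset.card_insert_of_notMem (by simp [hy]), Finset.card_erase_of_mem he]
    have := Finset.card_pos.2 ⟨e, he⟩
    simp; omega

theorem card_step (hs : ∀ j, ColStep (C j) (o j) (D j) (o (j + 1))) {g : ℕ} (hg : o g ≠ none)
    (hg1 : o (g + 1) = none) (j : ℕ) : (D j).card = (C j).card + if j = g then 1 else 0 := by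
  rw [(hs j).card_eq]
  congr 1
  refine if_congr ⟨fun ⟨h1, h2⟩ => ?_, ?_⟩ rfl rfl
  · by_contra hne
    rcases lt_or_gt_of_ne hne with h | h
    · exact hg (none_of_le hs h2 h)
    · exact h1 (none_of_le hs hg1 h)
  · rintro rfl; exact ⟨hg, hg1⟩

/-- Inserting a smaller letter afterwards creates a cell further right. -/
theorem lt_of_insert_lt (hs : ∀ j, ColStep (C j) (o j) (D j) (o (j + 1)))
    (ht : ∀ j, ColStep (D j) (p j) (E j) (p (j + 1))) {y x : ℕ} (hy : o 0 = some y)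
    (hx : p 0 = some x) (hxy : x < y) {g k : ℕ} (hg : o g ≠ none) (hk : p (k + 1) = none) :
    g < k := by
  have key : ∀ j c, o j = some c → ∃ d, p j = some d ∧ d < c := by
    intro j
    induction j with
    | zero => intro c hc; exact ⟨x, hx, by rw [hy] at hc; simp at hc; omega⟩
    | succ j ih =>
      intro c hc
      have h1 := hs j
      rcases hb : o j with _ | b
      · rw [hb] at h1; rw [h1.out_none.2] at hc; simp at hc
      obtain ⟨d, hd, hdb⟩ := ih b hb
      have h2 := ht j
      rw [hb, hc] at h1
      rw [hd] at h2
      have hm : b ∈ D j ∧ b < c := by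
        rcases h1 with ⟨h0, -⟩ | ⟨b', hb', -, ⟨h0, -⟩ | ⟨e, -, he, hlt, -, hD⟩⟩
        · simp at h0
        · simp at h0
        · simp at hb' he
          subst hb' he
          exact ⟨by simp [hD], hlt⟩
      rcases h2 with ⟨h0, -⟩ | ⟨d', hd', -, ⟨-, -, hall⟩ | ⟨e, he, hp, -, hmin, -⟩⟩
      · simp at h0
      · have := hall b hm.1
        simp at hd'; omega
      · simp at hd'
        exact ⟨e, hp, (hmin b hm.1 (by omega)).trans_lt hm.2⟩
  by_contra hlt
  obtain ⟨c, hc⟩ := Option.ne_none_iff_exists'.1 hg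
  obtain ⟨d, hd, hdc⟩ := key g c hc
  have h1 := hs g
  have h2 := ht g
  have hle : p (g + 1) = none := none_of_le ht hk (by omega)
  rw [hc] at h1
  rw [hd, hle] at h2
  have hm : c ∈ D g := by
    rcases h1 with ⟨h0, -⟩ | ⟨b, hb, -, ⟨-, hD, -⟩ | ⟨e, -, -, -, -, hD⟩⟩
    · simp at h0
    all_goals simp at hb; simp [hD, hb]
  rcases h2 with ⟨h0, -⟩ | ⟨b, hb, -, ⟨-, -, hall⟩ | ⟨e, -, h0, -⟩⟩
  · simp at h0
  · have := hall c hm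
    simp at hb; omega
  · simp at h0

end Stream

/-! ### Jeu de taquin on partial fillings -/

/-- The filling `f` with the entry in row `r` and column `c` replaced by `v`. -/
def put (f : ℕ → ℕ → Option ℕ) (r c : ℕ) (v : Option ℕ) : ℕ → ℕ → Option ℕ :=
  fun r' c' => if r' = r ∧ c' = c then v else f r' c'

theorem put_self (f : ℕ → ℕ → Option ℕ) (r c : ℕ) (v : Option ℕ) : put f r c v r c = v := by
  simp [put]

theorem put_of_ne {f : ℕ → ℕ → Option ℕ} {r c r' c' : ℕ} {v : Option ℕ}
    (h : ¬ (r' = r ∧ c' = c)) : put f r c v r' c' = f r' c' := by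
  rw [put, if_neg h]

theorem put_comm {f : ℕ → ℕ → Option ℕ} {r c r' c' : ℕ} {v v' : Option ℕ}
    (h : ¬ (r' = r ∧ c' = c)) : put (put f r c v) r' c' v' = put (put f r' c' v') r c v := by
  funext a b
  simp only [put]
  split_ifs <;> first | rfl | omega

theorem put_put (f : ℕ → ℕ → Option ℕ) (r c : ℕ) (v v' : Option ℕ) :
    put (put f r c v) r c v' = put f r c v' := by
  funext a b
  simp only [put]
  split_ifs <;> rfl

theorem put_eq_self {f : ℕ → ℕ → Option ℕ} {r c : ℕ} {v : Option ℕ} (h : f r c = v) :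
    put f r c v = f := by
  funext a b
  simp only [put]
  split_ifs with h' <;> simp [*]

/-- `Slide f r c f' r' c'`: the jeu de taquin slide of `f` starting with the empty tile at `(r, c)`
ends with the filling `f'`, the empty tile leaving at `(r', c')`. -/
inductive Slide : (ℕ → ℕ → Option ℕ) → ℕ → ℕ → (ℕ → ℕ → Option ℕ) → ℕ → ℕ → Prop
  | final {f r c} (h₁ : f r (c + 1) = none) (h₂ : f (r + 1) c = none) :
      Slide f r c (put f r c none) r c
  | right {f r c x f' r' c'} (h₁ : f r (c + 1) = some x) (h₂ : ∀ y, f (r + 1) c = some y → x < y)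
      (h₃ : Slide (put f r c (some x)) r (c + 1) f' r' c') : Slide f r c f' r' c'
  | down {f r c y f' r' c'} (h₁ : f (r + 1) c = some y)
      (h₂ : ∀ x, f r (c + 1) = some x → ¬ x < y)
      (h₃ : Slide (put f r c (some y)) (r + 1) c f' r' c') : Slide f r c f' r' c'

theorem Slide.add_le {f f' : ℕ → ℕ → Option ℕ} {r c r' c' : ℕ} (h : Slide f r c f' r' c') :
    r + c ≤ r' + c' := by
  induction h <;> omega

/-- A filling and a position `(r, c)` at which the largest entry `v` may be adjoined. -/
structure Addable (f : ℕ → ℕ → Option ℕ) (r c v : ℕ) : Prop where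
  self : f r c = none
  right : f r (c + 1) = none
  below : f (r + 1) c = none
  le : ∀ i j x, f i j = some x → x ≤ v ∧ (x = v → j < c)

theorem Addable.put {f : ℕ → ℕ → Option ℕ} {r c v i j x : ℕ} (h : Addable f r c v)
    (hij : f i j ≠ none) (hx : x ≤ v ∧ (x = v → j < c)) : Addable (put f i j (some x)) r c v where
  self := by rw [put_of_ne]; exact h.self; rintro ⟨rfl, rfl⟩; exact hij h.self
  right := by rw [put_of_ne]; exact h.right; rintro ⟨rfl, rfl⟩; exact hij h.right
  below := by rw [put_of_ne]; exact h.below; rintro ⟨rfl, rfl⟩; exact hij h.below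
  le := by
    intro a b y hy
    by_cases hab : a = i ∧ b = j
    · obtain ⟨rfl, rfl⟩ := hab
      rw [put_self] at hy
      obtain rfl : x = y := by simpa using hy
      exact hx
    · rw [put_of_ne hab] at hy
      exact h.le a b y hy

theorem Slide.add {f f' : ℕ → ℕ → Option ℕ} {r c r' c' br bc v : ℕ} (h : Slide f r c f' r' c')
    (hrc : f r c ≠ none) (hb : Addable f br bc v) :
    (((br = r' ∧ bc = c' + 1) ∨ (br = r' + 1 ∧ bc = c')) →
      Slide (put f br bc (some v)) r c (put f' r' c' (some v)) br bc) ∧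
    (¬ ((br = r' ∧ bc = c' + 1) ∨ (br = r' + 1 ∧ bc = c')) →
      Slide (put f br bc (some v)) r c (put f' br bc (some v)) r' c') := by
  induction h with
  | @final f r c h₁ h₂ =>
    have hne : ¬ (r = br ∧ c = bc) := by rintro ⟨rfl, rfl⟩; exact hrc hb.self
    refine ⟨?_, fun hadj => ?_⟩
    · rintro (⟨rfl, rfl⟩ | ⟨rfl, rfl⟩)
      · refine Slide.right (x := v) (put_self _ _ _ _) ?_ ?_
        · rw [put_of_ne (by omega), h₂]; simp
        · have h3 : Slide (BPDPaper.put (BPDPaper.put f br (c + 1) (some v)) br c (some v)) br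
              (c + 1) _ br (c + 1) := Slide.final
            (by rw [put_of_ne (by omega), put_of_ne (by omega)]; exact hb.right)
            (by rw [put_of_ne (by omega), put_of_ne (by omega)]; exact hb.below)
          convert h3 using 1
          rw [put_put, put_comm (r := br) (c := c) (by omega), put_put, put_eq_self h₁]
      · refine Slide.down (y := v) (put_self _ _ _ _) ?_ ?_
        · rw [put_of_ne (by omega), h₁]; simp
        · have h3 : Slide (BPDPaper.put (BPDPaper.put f (r + 1) bc (some v)) r bc (some v)) (r + 1)
              bc _ (r + 1) bc := Slide.final
            (by rw [put_of_ne (by omega), put_of_ne (by omega)]; exact hb.right)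
            (by rw [put_of_ne (by omega), put_of_ne (by omega)]; exact hb.below)
          convert h3 using 1
          rw [put_put, put_comm (r := r) (c := bc) (by omega), put_put, put_eq_self h₂]
    · rw [put_comm (by omega)]
      refine Slide.final ?_ ?_
      · rw [put_of_ne (by omega), h₁]
      · rw [put_of_ne (by omega), h₂]
  | @right f r c x f' r' c' h₁ h₂ h₃ ih =>
    have hne : ¬ (r = br ∧ c = bc) := by rintro ⟨rfl, rfl⟩; exact hrc hb.self
    have hne' : ¬ (r = br ∧ c + 1 = bc) := by
      rintro ⟨rfl, rfl⟩; rw [hb.self] at h₁; simp at h₁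
    have hx := hb.le _ _ _ h₁
    have hih := ih (by rw [put_of_ne (by omega), h₁]; simp)
      (hb.put hrc ⟨hx.1, fun e => by have := hx.2 e; omega⟩)
    have hr : BPDPaper.put f br bc (some v) r (c + 1) = some x := by rw [put_of_ne hne', h₁]
    have hd : ∀ y, BPDPaper.put f br bc (some v) (r + 1) c = some y → x < y := by
      intro y hy
      by_cases hbb : r + 1 = br ∧ c = bc
      · obtain ⟨rfl, rfl⟩ := hbb
        rw [put_self] at hy
        obtain rfl : v = y := by simpa using hy
        exact lt_of_le_of_ne hx.1 fun e => by have := hx.2 e; omega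
      · rw [put_of_ne hbb] at hy
        exact h₂ y hy
    rw [put_comm (by omega)] at hih
    exact ⟨fun h => Slide.right hr hd (hih.1 h), fun h => Slide.right hr hd (hih.2 h)⟩
  | @down f r c y f' r' c' h₁ h₂ h₃ ih =>
    have hne : ¬ (r = br ∧ c = bc) := by rintro ⟨rfl, rfl⟩; exact hrc hb.self
    have hne' : ¬ (r + 1 = br ∧ c = bc) := by
      rintro ⟨rfl, rfl⟩; rw [hb.self] at h₁; simp at h₁
    have hy := hb.le _ _ _ h₁
    have hih := ih (by rw [put_of_ne (by omega), h₁]; simp) (hb.put hrc hy)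
    have hd : BPDPaper.put f br bc (some v) (r + 1) c = some y := by rw [put_of_ne hne', h₁]
    have hr : ∀ x, BPDPaper.put f br bc (some v) r (c + 1) = some x → ¬ x < y := by
      intro x hx
      by_cases hbb : r = br ∧ c + 1 = bc
      · obtain ⟨rfl, rfl⟩ := hbb
        rw [put_self] at hx
        obtain rfl : v = x := by simpa using hx
        omega
      · rw [put_of_ne hbb] at hx
        exact h₂ x hx
    rw [put_comm (by omega)] at hih
    exact ⟨fun h => Slide.down hd hr (hih.1 h), fun h => Slide.down hd hr (hih.2 h)⟩

/-- The entry of a tableau, given by its rows, in row `r` and column `c`. -/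
def entry (T : List (List ℕ)) (r c : ℕ) : Option ℕ := (T.getD r [])[c]?

theorem entry_ne_none {T : List (List ℕ)} {r c : ℕ} (h : entry T r c ≠ none) :
    ∃ hr : r < T.length, c < T[r].length := by
  have hr : r < T.length := by
    by_contra hr
    apply h
    rw [entry, List.getD_eq_default _ _ (by omega)]
    simp
  refine ⟨hr, ?_⟩
  by_contra hc
  apply h
  rw [entry, List.getD_eq_getElem _ _ hr, List.getElem?_eq_none (by omega)]

theorem getD_set (T : List (List ℕ)) {r : ℕ} (hr : r < T.length) (l : List ℕ) (i : ℕ) :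
    (T.set r l).getD i [] = if i = r then l else T.getD i [] := by
  rw [List.getD_eq_getElem?_getD, List.getElem?_set]
  by_cases hi : i = r
  · rw [if_pos hi.symm, if_pos hr, if_pos hi]; rfl
  · rw [if_neg (Ne.symm hi), if_neg hi, List.getD_eq_getElem?_getD]

theorem entry_setEntry {T : List (List ℕ)} {r c : ℕ} (h : entry T r c ≠ none) (x : ℕ) :
    entry (setEntry T r c x) = put (entry T) r c (some x) := by
  obtain ⟨hr, hc⟩ := entry_ne_none h
  funext i j
  simp only [entry, setEntry, put]
  rw [getD_set T hr]
  by_cases hi : i = r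
  · subst hi
    rw [if_pos rfl, List.getD_eq_getElem _ _ hr, List.getElem?_set]
    split_ifs <;> grind
  · rw [if_neg hi, if_neg (by simp [hi])]

theorem setEntry_nonempty {T : List (List ℕ)} {r c : ℕ} (hT : ∀ row ∈ T, row ≠ [])
    (h : entry T r c ≠ none) (x : ℕ) : ∀ row ∈ setEntry T r c x, row ≠ [] := by
  obtain ⟨hr, hc⟩ := entry_ne_none h
  intro row hrow
  rcases List.mem_or_eq_of_mem_set hrow with h | rfl
  · exact hT _ h
  · rw [List.getD_eq_getElem _ _ hr]
    intro h0
    have := hT _ (List.getElem_mem hr)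
    simp at h0; contradiction

theorem entry_jdtAux {f f' : ℕ → ℕ → Option ℕ} {r c r' c' : ℕ} (h : Slide f r c f' r' c') :
    ∀ {T : List (List ℕ)} {fuel : ℕ}, entry T = f → (∀ row ∈ T, row ≠ []) → f r c ≠ none →
      r' + c' + 1 ≤ r + c + fuel →
      entry (jdtAux fuel T r c) = f' ∧ ∀ row ∈ jdtAux fuel T r c, row ≠ [] := by
  induction h with
  | @final f r c h₁ h₂ =>
    rintro T (_ | fuel) rfl hT hrc hfuel
    · omega
    obtain ⟨hr, hc⟩ := entry_ne_none hrc
    have hj : jdtAux (fuel + 1) T r c =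
        (T.set r ((T.getD r []).take c)).filter (fun row => !row.isEmpty) := by
      rw [entry] at h₁ h₂
      rw [jdtAux, h₁, h₂]
    rw [hj]
    refine ⟨?_, fun row hrow => by simpa using (List.mem_filter.1 hrow).2⟩
    have hlen : T[r].length = c + 1 := by
      rw [entry, List.getD_eq_getElem _ _ hr, List.getElem?_eq_none_iff] at h₁
      omega
    have key : ∀ i, ((T.set r ((T.getD r []).take c)).filter (fun row => !row.isEmpty)).getD i [] =
        (T.set r ((T.getD r []).take c)).getD i [] := by
      intro i
      rcases Nat.eq_zero_or_pos c with rfl | hpos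
      · have hlast : T.length = r + 1 := by
          by_contra hne
          have hr1 : r + 1 < T.length := by omega
          rw [entry, List.getD_eq_getElem _ _ hr1, List.getElem?_eq_none_iff] at h₂
          exact hT _ (List.getElem_mem hr1) (List.length_eq_zero_iff.1 (by omega))
        have hset : T.set r ((T.getD r []).take 0) = T.take r ++ [[]] := by
          rw [List.set_eq_take_append_cons_drop, if_pos hr, List.drop_eq_nil_of_le (by omega)]
          simp
        rw [hset, List.filter_append, List.filter_eq_self.2]
        · have hnil : [([] : List ℕ)].filter (fun row => !row.isEmpty) = [] := rfl
          rw [hnil, List.append_nil]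
          by_cases hi : i < (T.take r).length
          · rw [List.getD_append _ _ _ _ hi]
          · rw [List.getD_append_right _ _ _ _ (by omega), List.getD_eq_default _ _ (by omega)]
            rcases i - (T.take r).length with _ | n <;> rfl
        · intro row hrow
          simpa using hT row (List.mem_of_mem_take hrow)
      · rw [List.filter_eq_self.2]
        intro row hrow
        rcases List.mem_or_eq_of_mem_set hrow with h | rfl
        · simpa using hT row h
        · rw [List.getD_eq_getElem _ _ hr]
          have := hT _ (List.getElem_mem hr)
          simp [this]; omega
    funext i j
    rw [entry, key, getD_set T hr]
    simp only [put]
    by_cases hi : i = r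
    · subst hi
      rw [if_pos rfl, entry, List.getD_eq_getElem _ _ hr, List.getElem?_take]
      split_ifs with h1 h2 h2
      · omega
      · rfl
      · rfl
      · rw [List.getElem?_eq_none (by omega)]
    · rw [if_neg hi, if_neg (by simp [hi]), entry]
  | @right f r c x f' r' c' h₁ h₂ h₃ ih =>
    rintro T (_ | fuel) rfl hT hrc hfuel
    · have := h₃.add_le; omega
    have hj : jdtAux (fuel + 1) T r c = jdtAux fuel (setEntry T r c x) r (c + 1) := by
      rw [entry] at h₁
      rcases hy : (T.getD (r + 1) [])[c]? with _ | y
      · rw [jdtAux, h₁, hy]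
      · rw [jdtAux, h₁, hy]
        simp only
        rw [if_pos (h₂ y hy)]
    rw [hj]
    exact ih (entry_setEntry hrc x) (setEntry_nonempty hT hrc x)
      (by rw [put_of_ne (by omega), h₁]; simp) (by omega)
  | @down f r c y f' r' c' h₁ h₂ h₃ ih =>
    rintro T (_ | fuel) rfl hT hrc hfuel
    · have := h₃.add_le; omega
    have hj : jdtAux (fuel + 1) T r c = jdtAux fuel (setEntry T r c y) (r + 1) c := by
      rw [entry] at h₁
      rcases hx : (T.getD r [])[c + 1]? with _ | x
      · rw [jdtAux, h₁, hx]
      · rw [jdtAux, h₁, hx]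
        simp only
        rw [if_neg (h₂ x hx)]
    rw [hj]
    exact ih (entry_setEntry hrc y) (setEntry_nonempty hT hrc y)
      (by rw [put_of_ne (by omega), h₁]; simp) (by omega)

theorem add_lt_sum_length {T : List (List ℕ)} (hT : ∀ row ∈ T, row ≠ []) {r c : ℕ}
    (h : entry T r c ≠ none) : r + c < (T.map List.length).sum := by
  induction T generalizing r with
  | nil => simp [entry] at h
  | cons R T ih =>
    have h1 : 0 < R.length := List.length_pos_iff.2 (hT R (by simp))
    cases r with
    | zero =>
      obtain ⟨_, hc⟩ := entry_ne_none h
      simp at hc ⊢; omega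
    | succ r =>
      have := ih (fun row hrow => hT row (by simp [hrow])) (r := r) (by simpa [entry] using h)
      simp; omega

theorem entry_jdt {f' : ℕ → ℕ → Option ℕ} {r' c' : ℕ} {T : List (List ℕ)}
    (h : Slide (entry T) 0 0 f' r' c') (hT : ∀ row ∈ T, row ≠ []) (h0 : entry T 0 0 ≠ none)
    (hend : entry T r' c' ≠ none) : entry (jdt T) = f' ∧ ∀ row ∈ jdt T, row ≠ [] :=
  entry_jdtAux h rfl hT h0 (by have := add_lt_sum_length hT hend; omega)

theorem eq_of_entry_eq {T T' : List (List ℕ)} (hT : ∀ row ∈ T, row ≠ [])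
    (hT' : ∀ row ∈ T', row ≠ []) (h : entry T = entry T') : T = T' := by
  have hlen : ∀ {S : List (List ℕ)}, (∀ row ∈ S, row ≠ []) → ∀ r,
      entry S r 0 = none ↔ S.length ≤ r := by
    intro S hS r
    constructor
    · intro h0
      by_contra hr
      have hr : r < S.length := by omega
      rw [entry, List.getD_eq_getElem _ _ hr, List.getElem?_eq_none_iff] at h0
      exact hS _ (List.getElem_mem hr) (List.length_eq_zero_iff.1 (by omega))
    · intro hr
      rw [entry, List.getD_eq_default _ _ hr]; rfl
  have hl : T.length = T'.length := by
    apply le_antisymm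
    · rw [← hlen hT, h, hlen hT']
    · rw [← hlen hT', ← h, hlen hT]
  refine List.ext_getElem hl fun r hr hr' => List.ext_getElem? fun c => ?_
  have := congrFun (congrFun h r) c
  rwa [entry, entry, List.getD_eq_getElem _ _ hr, List.getD_eq_getElem _ _ hr'] at this

theorem lt_foldr_max {l : List ℕ} {i : ℕ} : i < l.foldr max 0 ↔ ∃ n ∈ l, i < n := by
  induction l with
  | nil => simp
  | cons a l ih => simp [ih]

theorem colsToRows_nonempty (cols : List (List ℕ)) : ∀ row ∈ colsToRows cols, row ≠ [] := by
  intro row hrow h0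
  simp only [colsToRows, List.mem_map, List.mem_range] at hrow
  obtain ⟨i, hi, rfl⟩ := hrow
  obtain ⟨n, hn, hin⟩ := lt_foldr_max.1 hi
  obtain ⟨C, hC, rfl⟩ := List.mem_map.1 hn
  rw [List.filterMap_eq_nil_iff] at h0
  have := h0 C hC
  simp at this; omega

theorem getElem?_filterMap_column {cols : List (List ℕ)}
    (h : ∀ j, (cols.getD (j + 1) []).length ≤ (cols.getD j []).length) (i c : ℕ) :
    (cols.filterMap fun col => col[i]?)[c]? = (cols.getD c [])[i]? := by
  induction cols generalizing c with
  | nil => simp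
  | cons C cols ih =>
    have ih := fun c => ih (fun j => by simpa using h (j + 1)) c
    rcases hC : C[i]? with _ | a
    · have hall : ∀ j, ((C :: cols).getD j [])[i]? = none := by
        intro j
        rw [List.getElem?_eq_none_iff] at hC ⊢
        induction j with
        | zero => simpa using hC
        | succ j ih => exact (h j).trans ih
      rw [hall c, List.filterMap_eq_nil_iff.2]
      · rfl
      · intro D hD
        obtain ⟨j, hj, rfl⟩ := List.getElem_of_mem hD
        have := hall j
        rwa [List.getD_eq_getElem _ _ hj] at this
    · rw [List.filterMap_cons, hC]
      cases c with
      | zero => simp [hC]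
      | succ c => simpa using ih c

theorem entry_colsToRows {cols : List (List ℕ)}
    (h : ∀ j, (cols.getD (j + 1) []).length ≤ (cols.getD j []).length) (r c : ℕ) :
    entry (colsToRows cols) r c = entry cols c r := by
  simp only [entry, colsToRows]
  by_cases hr : r < (cols.map List.length).foldr max 0
  · rw [List.getD_eq_getElem _ _ (by simpa using hr)]
    simp only [List.getElem_map, List.getElem_range]
    exact getElem?_filterMap_column h r c
  · rw [List.getD_eq_default _ _ (by simpa using hr)]
    rw [lt_foldr_max] at hr
    push Not at hr
    by_cases hc : c < cols.length
    · rw [List.getD_eq_getElem _ _ hc, List.getElem?_eq_none (l := cols[c])]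
      · rfl
      · exact hr _ (List.mem_map.2 ⟨_, List.getElem_mem hc, rfl⟩)
    · rw [List.getD_eq_default _ _ (by omega)]; rfl

/-! ### The recording tableau -/

/-- The entry of a tableau, given by its columns, in row `r` and column `c`. -/
def colEntry (Q : List (List ℕ)) (r c : ℕ) : Option ℕ := entry Q c r

/-- `PQ` is a pair of tableaux obtained by inserting a prefix of a word whose remaining letters
are `β`, where the word follows `α` in a reduced word of `w`. -/
structure EGState (w : Perm') (α : List ℕ) (PQ : List (List ℕ) × List (List ℕ)) (β : List ℕ) :
    Prop where
  sorted : ∀ C ∈ PQ.1, C.Pairwise (· < ·)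
  word : IsReducedWord w (α ++ (columnWord PQ.1 ++ β))
  tab : Tab (colSet PQ.1)
  length_eq : PQ.2.length = PQ.1.length
  card : ∀ j, (PQ.2.getD j []).length = (colSet PQ.1 j).card

theorem EGState.nil {w : Perm'} {α β : List ℕ} (h : IsReducedWord w (α ++ β)) :
    EGState w α ([], []) β where
  sorted := by simp
  word := by simpa [columnWord] using h
  tab := fun j t => by simp [colSet, cnt]
  length_eq := rfl
  card := by simp [colSet]

theorem EGState.colEntry_eq_none {w : Perm'} {α β : List ℕ}
    {PQ : List (List ℕ) × List (List ℕ)} (h : EGState w α PQ β) {r c : ℕ} :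
    colEntry PQ.2 r c = none ↔ (colSet PQ.1 c).card ≤ r := by
  rw [colEntry, entry, List.getElem?_eq_none_iff, h.card]

theorem EGState.entry_colsToRows {w : Perm'} {α β : List ℕ}
    {PQ : List (List ℕ) × List (List ℕ)} (h : EGState w α PQ β) :
    entry (colsToRows PQ.2) = colEntry PQ.2 := by
  funext r c
  refine BPDPaper.entry_colsToRows (fun j => ?_) r c
  rw [h.card, h.card]
  exact h.tab.card_le j

theorem EGState.step {w : Perm'} (hG : Grassmannian w) {α β : List ℕ} {y v : ℕ}
    {PQ : List (List ℕ) × List (List ℕ)} (h : EGState w α PQ (y :: β)) :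
    EGState w α (egStep PQ (v, y)) β ∧ ∃ (o : ℕ → Option ℕ) (g : ℕ), o 0 = some y ∧
      (∀ j, ColStep (colSet PQ.1 j) (o j) (colSet (egStep PQ (v, y)).1 j) (o (j + 1))) ∧
      o g ≠ none ∧ o (g + 1) = none ∧
      colEntry (egStep PQ (v, y)).2 = put (colEntry PQ.2) (colSet PQ.1 g).card g (some v) := by
  obtain ⟨h1, h2, h3, h4, o, h5, h6, h7, h8⟩ := egInsert_spec hG h.sorted h.word
  set g := (egInsert PQ.1 y).2 with hg
  have hP : (egStep PQ (v, y)).1 = (egInsert PQ.1 y).1 := rfl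
  have hQ : (egStep PQ (v, y)).2 = if g < PQ.2.length then PQ.2.set g (PQ.2.getD g [] ++ [v])
      else PQ.2 ++ [[v]] := rfl
  have hgle : g ≤ PQ.2.length := h.length_eq ▸ h3
  have hcol : ∀ j, (egStep PQ (v, y)).2.getD j [] =
      if j = g then PQ.2.getD j [] ++ [v] else PQ.2.getD j [] := by
    intro j
    rw [hQ]
    by_cases hlt : g < PQ.2.length
    · rw [if_pos hlt, getD_set _ hlt]
      split_ifs with hj
      · rw [hj]
      · rfl
    · have hgl : g = PQ.2.length := by omega
      rw [if_neg hlt, hgl]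
      rcases lt_trichotomy j PQ.2.length with hj | hj | hj
      · rw [List.getD_append _ _ _ _ hj, if_neg (by omega)]
      · rw [if_pos hj, List.getD_append_right _ _ _ _ (by omega), hj,
          List.getD_eq_default PQ.2 _ le_rfl]
        simp
      · rw [if_neg (by omega), List.getD_eq_default _ _ (by simp; omega),
          List.getD_eq_default _ _ (by omega)]
  refine ⟨⟨h1, h2, h.tab.step h6, ?_, fun j => ?_⟩, o, g, h5, h6, h7, h8, ?_⟩
  · rw [hP, h4, hQ]
    have := h.length_eq
    split_ifs <;> simp <;> omega
  · rw [hP, hcol, card_step h6 h7 h8, ← h.card]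
    split_ifs <;> simp
  · funext r c
    simp only [colEntry, entry, hcol, put]
    by_cases hc : c = g
    · subst hc
      rw [if_pos rfl, ← h.card, List.getElem?_append]
      split_ifs with hr hr' hr'
      · omega
      · rfl
      · simp [hr'.1]
      · rw [List.getElem?_eq_none (l := [v]) (by rw [List.length_singleton]; omega),
          List.getElem?_eq_none (by omega)]
    · rw [if_neg hc, if_neg (by simp [hc])]

/-- The states `PQ` and `PQ'` reached by inserting a word without and with the additional first
letter `x`; the last column of the biword is `(r, y)`. -/
structure PairState (w : Perm') (x : ℕ) (β : List ℕ) (r y : ℕ)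
    (PQ PQ' : List (List ℕ) × List (List ℕ)) : Prop where
  state : EGState w [x] PQ β
  state' : EGState w [] PQ' β
  slide : ∃ h z, PairInv (colSet PQ.1) (colSet PQ'.1) h z ∧
    Slide (colEntry PQ'.2) 0 0 (colEntry PQ.2) (colSet PQ.1 h).card h
  corner : colEntry PQ'.2 0 0 ≠ none
  last : ∃ (C : ℕ → Finset ℕ) (o : ℕ → Option ℕ) (g : ℕ),
    (∀ j, ColStep (C j) (o j) (colSet PQ'.1 j) (o (j + 1))) ∧ o 0 = some y ∧ o g ≠ none ∧
    ∀ i j v, colEntry PQ'.2 i j = some v → v ≤ r ∧ (v = r → j ≤ g)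

theorem PairState.singleton {w : Perm'} (hG : Grassmannian w) {x r : ℕ} {β : List ℕ}
    (h : IsReducedWord w (x :: β)) :
    PairState w x β r x ([], []) (egStep ([], []) (r, x)) := by
  obtain ⟨h1, o, g, h2, h3, h4, -⟩ :=
    (EGState.nil (α := []) h).step hG (v := r)
  have hc : ∀ i j, colEntry (egStep ([], []) (r, x)).2 i j =
      if i = 0 ∧ j = 0 then some r else none := by
    intro i j
    rcases i with _ | i <;> rcases j with _ | j <;> simp [colEntry, entry, egStep, egInsert]
  refine ⟨EGState.nil h, h1, ⟨0, fun _ => x, ⟨by simp, ?_, fun j hj => Or.inl ⟨rfl, ?_⟩, ?_, ?_⟩, ?_⟩,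
    by simp [hc], _, o, g, h3, h2, h4, ?_⟩
  · simp [colSet, egStep, egInsert]
  · obtain ⟨i, rfl⟩ : ∃ i, j = i + 1 := ⟨j - 1, by omega⟩
    simp [colSet, egStep, egInsert]
  · simp [colSet]
  · simp [colSet, cnt]
  · have hs : Slide (colEntry (egStep ([], []) (r, x)).2) 0 0 _ 0 0 :=
      Slide.final (by simp [hc]) (by simp [hc])
    convert hs using 1
    · funext i j
      simp only [put, hc]
      split_ifs <;> simp [colEntry, entry]
    · simp [colSet]
  · intro i j v hv
    rw [hc] at hv
    split_ifs at hv with hij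
    simp at hv
    omega

theorem PairState.step {w : Perm'} (hG : Grassmannian w) {x r y r' y' : ℕ} {β : List ℕ}
    {PQ PQ' : List (List ℕ) × List (List ℕ)} (H : PairState w x (y' :: β) r y PQ PQ')
    (hlt : r < r' ∨ (r = r' ∧ y' < y)) :
    PairState w x β r' y' (egStep PQ (r', y')) (egStep PQ' (r', y')) := by
  obtain ⟨s1, o, g, o0, os, og, og1, oQ⟩ := H.state.step hG (v := r')
  obtain ⟨s1', o', g', o0', os', og', og1', oQ'⟩ := H.state'.step hG (v := r')
  obtain ⟨h, z, hpair, hslide⟩ := H.slide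
  obtain ⟨C₀, o₀, g₀, hs₀, ho₀, hg₀, hval⟩ := H.last
  have hval' : ∀ i j v, colEntry PQ'.2 i j = some v → v ≤ r' ∧ (v = r' → j < g') := by
    intro i j v hv
    have hv := hval i j v hv
    refine ⟨by omega, fun e => ?_⟩
    have := lt_of_insert_lt hs₀ os' ho₀ o0' (by omega) hg₀ og1'
    omega
  have hadd : Addable (colEntry PQ'.2) (colSet PQ'.1 g').card g' r' :=
    ⟨H.state'.colEntry_eq_none.2 le_rfl,
      H.state'.colEntry_eq_none.2 (H.state'.tab.card_le g'),
      H.state'.colEntry_eq_none.2 (by omega), hval'⟩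
  have hext := hslide.add H.corner hadd
  have hne0 : ¬ (0 = (colSet PQ'.1 g').card ∧ 0 = g') := by
    rintro ⟨h1, rfl⟩
    have h2 := hadd.self
    rw [← h1] at h2
    exact H.corner h2
  have hD := card_step os og og1
  obtain ⟨h', z', hpair', hcase⟩ := hpair.step H.state.tab H.state'.tab os os' (o0.trans o0'.symm)
  refine ⟨s1, s1', ⟨h', z', hpair', ?_⟩, ?_, colSet PQ'.1, o', g', os', o0', og', ?_⟩
  · rw [oQ, oQ']
    rcases hcase with ⟨rfl, hiff⟩ | ⟨rfl, e1, e2, e3, e4, e5⟩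
    · have hgg : g' = g := by
        by_contra hne
        rcases lt_or_gt_of_ne hne with hl | hl
        · exact og (none_of_le os ((hiff _).2 og1') hl)
        · exact og' (none_of_le os' ((hiff _).1 og1) hl)
      subst hgg
      rw [hD]
      by_cases hgh : g' = h'
      · subst hgh
        have hc : (colSet PQ'.1 g').card = (colSet PQ.1 g').card + 1 := by
          rw [hpair.hole, Finset.card_insert_of_notMem (hpair.notMem _ le_rfl)]
        rw [if_pos rfl, ← hc]
        exact hext.1 (Or.inr ⟨hc, rfl⟩)
      · have hc : (colSet PQ'.1 g').card = (colSet PQ.1 g').card := by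
          rcases lt_or_gt_of_ne hgh with hl | hl
          · rw [hpair.left _ hl]
          · rcases hpair.right _ hl with ⟨-, e⟩ | ⟨hlt', hm, hn, e⟩
            · rw [e]
            · rw [e, Finset.card_insert_of_notMem (by simp [hn]), Finset.card_erase_of_mem hm]
              have := Finset.card_pos.2 ⟨_, hm⟩
              omega
        rw [if_neg (by omega), add_zero, ← hc]
        refine hext.2 ?_
        rintro (⟨e1, e2⟩ | ⟨e1, e2⟩)
        · have h1 := s1.tab.card_le h'
          rw [hD, hD, ← e2, if_pos rfl, if_neg (by omega)] at h1
          omega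
        · exact hgh e2
    · have hg : g = h := by
        by_contra hne
        rcases lt_or_gt_of_ne hne with hl | hl
        · exact e1 (none_of_le os og1 hl)
        · exact og (none_of_le os e2 hl)
      have hg' : g' = h + 1 := by
        by_contra hne
        rcases lt_or_gt_of_ne hne with hl | hl
        · exact e3 (none_of_le os' og1' hl)
        · exact og' (none_of_le os' e4 hl)
      subst hg hg'
      have hc : (colSet PQ'.1 (g + 1)).card = (colSet PQ.1 (g + 1)).card := by
        rcases hpair.right (g + 1) (by omega) with ⟨-, e⟩ | ⟨hlt', hm, hn, e⟩
        · rw [e]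
        · rw [e, Finset.card_insert_of_notMem (by simp [hn]), Finset.card_erase_of_mem hm]
          have := Finset.card_pos.2 ⟨_, hm⟩
          omega
      rw [hD, if_neg (by omega), add_zero, ← hc]
      exact hext.1 (Or.inl ⟨by omega, rfl⟩)
  · rw [oQ', put_of_ne hne0]
    exact H.corner
  · intro i j v hv
    rw [oQ'] at hv
    by_cases hij : i = (colSet PQ'.1 g').card ∧ j = g'
    · obtain ⟨rfl, rfl⟩ := hij
      rw [put_self] at hv
      simp at hv
      omega
    · rw [put_of_ne hij] at hv
      have := hval' i j v hv
      exact ⟨this.1, fun e => (this.2 e).le⟩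

theorem PairState.foldl {w : Perm'} (hG : Grassmannian w) {x : ℕ} :
    ∀ {l : List (ℕ × ℕ)} {r y : ℕ} {PQ PQ' : List (List ℕ) × List (List ℕ)},
      PairState w x (l.map Prod.snd) r y PQ PQ' →
      List.IsChain (fun p q : ℕ × ℕ => p.1 < q.1 ∨ (p.1 = q.1 ∧ q.2 < p.2)) ((r, y) :: l) →
      ∃ r' y', PairState w x [] r' y' (l.foldl egStep PQ) (l.foldl egStep PQ')
  | [], r, y, _, _, H, _ => ⟨r, y, H⟩
  | (r', y') :: l, r, y, PQ, PQ', H, hl => by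
    rw [List.isChain_cons_cons] at hl
    have H' := PairState.step hG H hl.1
    exact PairState.foldl (PQ := egStep PQ (r', y')) (PQ' := egStep PQ' (r', y')) hG H' hl.2

theorem isChain_zip_of_isCompatible {w : Perm'} {P : Biword} (hP : IsCompatible w P) :
    List.IsChain (fun p q : ℕ × ℕ => p.1 < q.1 ∨ (p.1 = q.1 ∧ q.2 < p.2)) (P.top.zip P.bot) := by
  obtain ⟨h1, h2, h3, h4⟩ := hP
  have hlen := h3.length_eq
  replace h2 : List.IsChain (· ≤ ·) P.top := h2
  rw [List.isChain_iff_getElem] at h2 ⊢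
  intro i hi
  simp only [List.length_zip] at hi
  simp only [List.getElem_zip]
  have hle := h2 i (by omega)
  have hcomp := h4 i (by omega)
  rw [List.getD_eq_getElem _ _ (by omega), List.getD_eq_getElem _ _ (by omega),
    List.getD_eq_getElem _ _ (by omega), List.getD_eq_getElem _ _ (by omega)] at hcomp
  have hne : P.bot[i] ≠ P.bot[i + 1] := by
    intro e
    have h5 := h1
    rw [← List.take_append_drop i P.bot, List.drop_eq_getElem_cons (by omega),
      List.drop_eq_getElem_cons (i := i + 1) (by omega), e] at h5
    exact h5.not_square
  omega

/-- If `(r_1,…,r_l ; a_1,…,a_l)` is a reduced compatible sequence for a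
Grassmannian permutation, then `Q̃((r_2,…,r_l ; a_2,…,a_l)) = jdt(Q̃((r_1,…,r_l ; a_1,…,a_l)))`:
deleting the first column of the biword corresponds to a jeu de taquin slide on the
Edelman–Greene recording tableau. -/
theorem stmt5 (w : Perm') (hG : Grassmannian w) (P : Biword)
    (hP : IsCompatible w P) (hne : P.bot ≠ []) :
    Qtilde ⟨P.top.tail, P.bot.tail⟩ = jdt (Qtilde P) := by
  have hchain := isChain_zip_of_isCompatible hP
  have hlen := hP.2.2.1.length_eq
  have hred := hP.1
  obtain ⟨top, bot⟩ := P
  obtain ⟨x, u, rfl⟩ := List.exists_cons_of_ne_nil hne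
  obtain ⟨r, ru, rfl⟩ := List.exists_cons_of_length_eq_add_one hlen
  have hmap : (ru.zip u).map Prod.snd = u :=
    List.map_snd_zip (by simpa using hlen.ge)
  have hinit := PairState.singleton hG (r := r) (β := (ru.zip u).map Prod.snd)
    (by rw [hmap]; exact hred)
  obtain ⟨_, _, H⟩ := PairState.foldl hG hinit hchain
  have hQ : Qtilde ⟨ru, u⟩ = colsToRows ((ru.zip u).foldl egStep ([], [])).2 := rfl
  have hQ' : Qtilde ⟨r :: ru, x :: u⟩ =
    colsToRows ((ru.zip u).foldl egStep (egStep ([], []) (r, x))).2 := rfl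
  obtain ⟨h, z, hpair, hslide⟩ := H.slide
  rw [← H.state.entry_colsToRows, ← H.state'.entry_colsToRows, ← hQ, ← hQ'] at hslide
  have hent := H.state'.entry_colsToRows
  rw [← hQ'] at hent
  obtain ⟨e1, e2⟩ := entry_jdt hslide (hQ' ▸ colsToRows_nonempty _) (hent ▸ H.corner) (by
    rw [hent, Ne, H.state'.colEntry_eq_none, hpair.hole,
      Finset.card_insert_of_notMem (hpair.notMem _ le_rfl)]
    omega)
  exact eq_of_entry_eq (hQ ▸ colsToRows_nonempty _) e2 e1.symm

end BPDPaper
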